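/- arXiv:1911.09136 — 3 statements merged into one kernel-verified Lean document; each statement's English description precedes it below -/
import Mathlib

section
/- Let f_1, …, f_k : ℕ → ℕ be functions given by polynomials with integer coefficients, and for each n let S_n ⊆ ℕ be the additive submonoid generated by f_1(n), …, f_k(n). Then there is an eventually quasi-polynomial function g : ℕ → ℤ such that for every n for which ℕ \ S_n is finite, the genus |ℕ \ S_n| equals g(n). -/
/-- A function `c : ℕ → ℚ` is eventually periodic if there are `N` and `p ≥ 1`
with `c (n + p) = c n` for all `n ≥ N`. -/
def EvPeriodic (c : ℕ → ℚ) : Prop :=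
  ∃ N p : ℕ, 1 ≤ p ∧ ∀ n, N ≤ n → c (n + p) = c n

/-- A function `g : ℕ → ℤ` is eventually quasi-polynomial if
`g n = Σ_{i=0}^d c_i(n)·n^i` for eventually periodic `c_0, …, c_d : ℕ → ℚ`. -/
def IsEQP (g : ℕ → ℤ) : Prop :=
  ∃ (d : ℕ) (c : ℕ → ℕ → ℚ), (∀ i, i ≤ d → EvPeriodic (c i)) ∧
    ∀ n : ℕ, (g n : ℚ) = ∑ i ∈ Finset.range (d + 1), c i n * (n : ℚ) ^ i

/-- The additive submonoid of `ℕ` generated by `f 0 n, …, f (k-1) n`. -/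
def SG (k : ℕ) (f : Fin k → ℕ → ℕ) (n : ℕ) : AddSubmonoid ℕ :=
  AddSubmonoid.closure (Set.range fun i => f i n)

namespace QuasiPoly

open Polynomial Filter

/-- The shift operator `F ↦ F (· + 1)` on rational sequences. -/
noncomputable def shift : Module.End ℚ (ℕ → ℚ) := LinearMap.funLeft ℚ ℚ Nat.succ

/-- Sequences that vanish from some point on. -/
def evZero : Submodule ℚ (ℕ → ℚ) where
  carrier := {F | ∀ᶠ n in atTop, F n = 0}
  zero_mem' := by simp
  add_mem' := by
    intro F G hF hG
    filter_upwards [hF, hG] with n h1 h2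
    simp [h1, h2]
  smul_mem' := by
    intro c F hF
    filter_upwards [hF] with n h1
    simp [h1]

lemma mem_evZero {F : ℕ → ℚ} : F ∈ evZero ↔ ∀ᶠ n in atTop, F n = 0 := Iff.rfl

/-- Sequences that are eventually annihilated by a power of `E ^ p - 1`, where `E` is the shift. -/
def IsQP (F : ℕ → ℚ) : Prop :=
  ∃ p : ℕ, 1 ≤ p ∧ ∃ e : ℕ, aeval shift ((X ^ p - 1 : ℚ[X]) ^ e) F ∈ evZero

lemma shift_pow_apply (d : ℕ) (F : ℕ → ℚ) (n : ℕ) : (shift ^ d) F n = F (n + d) := by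
  induction d generalizing n with
  | zero => simp
  | succ d ih =>
    rw [pow_succ', Module.End.mul_apply, shift, LinearMap.funLeft_apply, ← shift, ih]
    congr 1
    simp only [Nat.succ_eq_add_one]
    omega

lemma aeval_X_pow_sub_one (d : ℕ) (F : ℕ → ℚ) :
    aeval shift (X ^ d - 1 : ℚ[X]) F = fun n => F (n + d) - F n := by
  ext n
  simp [shift_pow_apply]

lemma aeval_shift_mem (P : ℚ[X]) {F : ℕ → ℚ} (hF : F ∈ evZero) : aeval shift P F ∈ evZero := by
  induction P using Polynomial.induction_on' with
  | add P Q hP hQ =>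
    rw [map_add]
    exact add_mem hP hQ
  | monomial n a =>
    rw [aeval_monomial, Module.End.mul_apply, Module.algebraMap_end_apply]
    refine evZero.smul_mem a ?_
    obtain ⟨N, hN⟩ := eventually_atTop.1 hF
    refine eventually_atTop.2 ⟨N, fun m hm => ?_⟩
    rw [shift_pow_apply]
    exact hN _ (by omega)

lemma aeval_shift_mem_of_dvd {P Q : ℚ[X]} (h : P ∣ Q) {F : ℕ → ℚ}
    (hF : aeval shift P F ∈ evZero) : aeval shift Q F ∈ evZero := by
  obtain ⟨R, rfl⟩ := h
  rw [mul_comm, map_mul, Module.End.mul_apply]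
  exact aeval_shift_mem R hF

lemma X_pow_sub_one_pow_dvd {p q e e' : ℕ} (h : p ∣ q) (he : e ≤ e') :
    (X ^ p - 1 : ℚ[X]) ^ e ∣ (X ^ q - 1) ^ e' := by
  refine (pow_dvd_pow _ he).trans (pow_dvd_pow_of_dvd ?_ _)
  obtain ⟨r, rfl⟩ := h
  rw [pow_mul]
  simpa using sub_dvd_pow_sub_pow (X ^ p : ℚ[X]) 1 r

lemma IsQP.of_mem {F : ℕ → ℚ} (hF : F ∈ evZero) : IsQP F :=
  ⟨1, le_rfl, 0, by simpa using hF⟩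

lemma IsQP.add {F G : ℕ → ℚ} (hF : IsQP F) (hG : IsQP G) : IsQP (F + G) := by
  obtain ⟨p, hp, e, h⟩ := hF
  obtain ⟨q, hq, e', h'⟩ := hG
  refine ⟨p * q, Nat.mul_pos hp hq, max e e', ?_⟩
  rw [map_add]
  exact add_mem
    (aeval_shift_mem_of_dvd (X_pow_sub_one_pow_dvd (dvd_mul_right p q) (le_max_left _ _)) h)
    (aeval_shift_mem_of_dvd (X_pow_sub_one_pow_dvd (dvd_mul_left q p) (le_max_right _ _)) h')

lemma IsQP.neg {F : ℕ → ℚ} (hF : IsQP F) : IsQP (-F) := by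
  obtain ⟨p, hp, e, h⟩ := hF
  refine ⟨p, hp, e, ?_⟩
  rw [map_neg]
  exact neg_mem h

lemma IsQP.congr {F G : ℕ → ℚ} (hF : IsQP F) (h : ∀ᶠ n in atTop, F n = G n) : IsQP G := by
  have : IsQP (G - F) := IsQP.of_mem <| by
    filter_upwards [h] with n hn
    simp [hn]
  simpa using this.add hF

lemma IsQP.sum {ι : Type*} (s : Finset ι) (F : ι → ℕ → ℚ) (h : ∀ i ∈ s, IsQP (F i)) :
    IsQP (fun n => ∑ i ∈ s, F i n) := by
  classical
  induction s using Finset.induction_on with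
  | empty => exact IsQP.of_mem (by simp [evZero])
  | insert a s ha ih =>
    have := (h a (by simp)).add (ih fun i hi => h i (by simp [hi]))
    refine this.congr (Eventually.of_forall fun n => ?_)
    simp [Finset.sum_insert ha]

/-- The class `IsQP` is closed under solving `F (n + d) - F n = E n`. -/
lemma IsQP.of_sub {F : ℕ → ℚ} {d : ℕ} (hd : 1 ≤ d) (h : IsQP fun n => F (n + d) - F n) :
    IsQP F := by
  obtain ⟨p, hp, e, h⟩ := h
  refine ⟨p * d, Nat.mul_pos hp hd, e + 1, ?_⟩
  rw [← aeval_X_pow_sub_one, ← Module.End.mul_apply, ← map_mul] at h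
  refine aeval_shift_mem_of_dvd ?_ h
  rw [pow_succ]
  refine mul_dvd_mul (X_pow_sub_one_pow_dvd (dvd_mul_right p d) le_rfl) ?_
  simpa using X_pow_sub_one_pow_dvd (e := 1) (e' := 1) (dvd_mul_left d p) le_rfl

lemma isQP_shift_iff {F : ℕ → ℚ} (d : ℕ) : IsQP (fun n => F (n + d)) ↔ IsQP F := by
  have key : ∀ P : ℚ[X], aeval shift P (fun n => F (n + d)) ∈ evZero ↔
      aeval shift P F ∈ evZero := by
    intro P
    have h1 : (fun n => F (n + d)) = aeval shift (X ^ d : ℚ[X]) F := by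
      ext n
      simp [shift_pow_apply]
    rw [h1, ← Module.End.mul_apply, ← map_mul, mul_comm, map_mul, Module.End.mul_apply]
    simp only [mem_evZero, map_pow, aeval_X, shift_pow_apply]
    exact ⟨fun h => by
      obtain ⟨N, hN⟩ := eventually_atTop.1 h
      refine eventually_atTop.2 ⟨N + d, fun n hn => ?_⟩
      have := hN (n - d) (by omega)
      rwa [Nat.sub_add_cancel (by omega)] at this, fun h => by
      obtain ⟨N, hN⟩ := eventually_atTop.1 h
      exact eventually_atTop.2 ⟨N, fun n hn => hN _ (by omega)⟩⟩
  simp only [IsQP, key]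

lemma aeval_X_pow_sub_one_pow (p e : ℕ) (F : ℕ → ℚ) :
    aeval shift ((X ^ p - 1 : ℚ[X]) ^ e) F = (fwdDiff p)^[e] F := by
  induction e generalizing F with
  | zero => simp
  | succ e ih =>
    rw [pow_succ, map_mul, Module.End.mul_apply, aeval_X_pow_sub_one, ih,
      Function.iterate_succ_apply]
    rfl

/-- The polynomial interpolating `m ↦ choose m k`. -/
lemma exists_choose_poly (k : ℕ) : ∃ P : ℚ[X], ∀ m : ℕ, P.eval (m : ℚ) = m.choose k := by
  refine ⟨C ((k.factorial : ℚ)⁻¹) * descPochhammer ℚ k, fun m => ?_⟩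
  rw [Nat.cast_choose_eq_descPochhammer_div, eval_mul, eval_C, div_eq_inv_mul]

/-- Along an arithmetic progression an element of `IsQP` is eventually polynomial. -/
lemma IsQP.exists_poly {F : ℕ → ℚ} (hF : IsQP F) :
    ∃ N p : ℕ, 1 ≤ p ∧ ∃ P : ℕ → ℚ[X], ∀ n, N ≤ n →
      F n = (P ((n - N) % p)).eval (n : ℚ) := by
  obtain ⟨p, hp, e, h⟩ := hF
  obtain ⟨N, hN⟩ := eventually_atTop.1 h
  rw [aeval_X_pow_sub_one_pow] at hN
  choose B hB using exists_choose_poly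
  refine ⟨N, p, hp, fun r => (∑ k ∈ Finset.range e,
    C ((fwdDiff p)^[k] F (N + r)) * B k).comp (C ((p : ℚ)⁻¹) * (X - C ((N : ℚ) + r))),
    fun n hn => ?_⟩
  set r := (n - N) % p
  set m := (n - N) / p
  have hn' : n = N + r + m • p := by
    have : r + p * m = n - N := Nat.mod_add_div (n - N) p
    rw [smul_eq_mul, mul_comm]
    omega
  have hm : (p : ℚ)⁻¹ * ((n : ℚ) - (N + r)) = m := by
    have hp' : (p : ℚ) ≠ 0 := by positivity
    rw [hn']
    push_cast
    field_simp
    ring_nf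
    simp
  rw [eval_comp, eval_mul, eval_C, eval_sub, eval_X, eval_C, hm, eval_finsetSum]
  conv_lhs => rw [hn', shift_eq_sum_fwdDiff_iter p F m (N + r)]
  have hvan : ∀ k, e ≤ k → (fwdDiff p)^[k] F (N + r) = 0 := by
    intro k hk
    obtain ⟨j, rfl⟩ := Nat.exists_eq_add_of_le hk
    have : ∀ j n, N ≤ n → (fwdDiff p)^[e + j] F n = 0 := by
      intro j
      induction j with
      | zero => exact fun n hn => hN n hn
      | succ j ih =>
        intro n hn
        rw [← add_assoc, Function.iterate_succ_apply', fwdDiff, ih _ (by omega), ih _ hn, sub_zero]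
    exact this j _ (by omega)
  have h1 : ∀ M, m + 1 ≤ M → ∑ k ∈ Finset.range (m + 1), m.choose k • (fwdDiff p)^[k] F (N + r)
      = ∑ k ∈ Finset.range M, m.choose k • (fwdDiff p)^[k] F (N + r) := by
    intro M hM
    refine Finset.sum_subset (Finset.range_mono hM) fun k _ hk => ?_
    rw [Nat.choose_eq_zero_of_lt (by simpa using hk), zero_smul]
  rw [h1 (max (m + 1) e) (le_max_left _ _)]
  symm
  simp only [eval_mul, eval_C, hB, nsmul_eq_mul, mul_comm]
  refine Finset.sum_subset (Finset.range_mono (le_max_right _ _)) fun k _ hk => ?_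
  rw [hvan k (by simpa using hk), mul_zero]

lemma IsQP.isEQP {g : ℕ → ℤ} (hg : IsQP fun n => (g n : ℚ)) : IsEQP g := by
  obtain ⟨N, p, hp, P, hP⟩ := hg.exists_poly
  let d := (Finset.range p).sup fun r => (P r).natDegree
  refine ⟨d, fun i n => if N ≤ n then (P ((n - N) % p)).coeff i else if i = 0 then g n else 0,
    fun i _ => ⟨N, p, hp, fun n hn => ?_⟩, fun n => ?_⟩
  · have : n + p - N = n - N + p := by omega
    simp [hn, this, show N ≤ n + p by omega]
  · by_cases hn : N ≤ n
    · have hr : (P ((n - N) % p)).natDegree < d + 1 :=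
        Nat.lt_succ_of_le (Finset.le_sup (f := fun r => (P r).natDegree)
          (Finset.mem_range.2 (Nat.mod_lt _ hp)))
      simp only [hn, if_true]
      rw [← eval_eq_sum_range' hr]
      exact hP n hn
    · simp [hn, Finset.sum_ite_eq', ite_mul]

lemma wellFoundedLT_lowerSet {α : Type*} [PartialOrder α] [WellQuasiOrderedLE α] :
    WellFoundedLT (LowerSet α) := by
  rw [WellFoundedLT, isWellFounded_iff, wellFounded_iff_isEmpty_descending_chain]
  refine ⟨fun ⟨D, hD⟩ => ?_⟩
  have hanti : StrictAnti D := strictAnti_nat_of_succ_lt hD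
  choose x hx hx' using fun i => Set.exists_of_ssubset (LowerSet.coe_ssubset_coe.2 (hD i))
  obtain ⟨i, j, hij, hle⟩ := wellQuasiOrdered_le x
  exact hx' i ((D (i + 1)).lower hle (hanti.antitone (Nat.succ_le_of_lt hij) (hx j)))

lemma finite_weight_eq {t : ℕ} {d : Fin t → ℕ} (hd : ∀ i, 1 ≤ d i)
    (D : LowerSet (Fin t → ℕ)) (n : ℕ) : {k | k ∈ D ∧ ∑ i, k i * d i = n}.Finite := by
  refine (Set.finite_Iic (fun _ : Fin t => n)).subset ?_
  rintro k ⟨-, rfl⟩ i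
  exact (Nat.le_mul_of_pos_right _ (hd i)).trans
    (Finset.single_le_sum (f := fun i => k i * d i) (fun _ _ => Nat.zero_le _) (Finset.mem_univ i))

/-- The translate by one in the first coordinate of a lower set. -/
def lowerShift {t : ℕ} (D : LowerSet (Fin (t + 1) → ℕ)) : LowerSet (Fin (t + 1) → ℕ) where
  carrier := {k | k + Pi.single 0 1 ∈ D}
  lower' := fun _ _ hab ha => D.lower (add_le_add_left hab _) ha

/-- The slice of a lower set on which the first coordinate vanishes. -/
def lowerSlice {t : ℕ} (D : LowerSet (Fin (t + 1) → ℕ)) : LowerSet (Fin t → ℕ) where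
  carrier := {k | (Fin.cons 0 k : Fin (t + 1) → ℕ) ∈ D}
  lower' := fun _ _ hab ha => D.lower (Fin.cons_le_cons.2 ⟨le_rfl, hab⟩) ha

lemma ncard_lowerSet_succ {t : ℕ} {d : Fin (t + 1) → ℕ} (hd : ∀ i, 1 ≤ d i)
    (D : LowerSet (Fin (t + 1) → ℕ)) (n : ℕ) :
    {k | k ∈ D ∧ ∑ i, k i * d i = n + d 0}.ncard =
      {k | k ∈ lowerSlice D ∧ ∑ i, k i * d i.succ = n + d 0}.ncard +
        {k | k ∈ lowerShift D ∧ ∑ i, k i * d i = n}.ncard := by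
  have hcons : Function.Injective (fun k : Fin t → ℕ => (Fin.cons 0 k : Fin (t + 1) → ℕ)) :=
    Fin.cons_right_injective (α := fun _ => ℕ) 0
  have hadd : Function.Injective (fun k : Fin (t + 1) → ℕ => k + Pi.single 0 1) :=
    add_left_injective _
  rw [← Set.ncard_image_of_injective _ hcons,
    ← Set.ncard_image_of_injective {k | k ∈ lowerShift D ∧ ∑ i, k i * d i = n} hadd,
    ← Set.ncard_union_eq ?_ ((finite_weight_eq (fun i => hd i.succ) _ _).image _)
      ((finite_weight_eq hd _ _).image _)]
  · congr 1
    ext k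
    simp only [Set.mem_ofPred_eq, Set.mem_union, Set.mem_image]
    constructor
    · rintro ⟨hk, hw⟩
      rcases Nat.eq_zero_or_pos (k 0) with h0 | h0
      · left
        refine ⟨Fin.tail k, ⟨?_, ?_⟩, ?_⟩
        · change (Fin.cons 0 (Fin.tail k) : Fin (t + 1) → ℕ) ∈ D
          rwa [← h0, Fin.cons_self_tail]
        · rw [Fin.sum_univ_succ, h0] at hw
          simpa [Fin.tail] using hw
        · rw [← h0, Fin.cons_self_tail]
      · right
        have hk1 : k - Pi.single 0 1 + Pi.single 0 1 = k := by
          refine tsub_add_cancel_of_le fun i => ?_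
          by_cases hi : i = 0
          · subst hi
            simpa using Nat.succ_le_of_lt h0
          · simp [hi]
        refine ⟨k - Pi.single 0 1, ⟨?_, ?_⟩, hk1⟩
        · change k - Pi.single 0 1 + Pi.single 0 1 ∈ D
          rwa [hk1]
        · rw [← hk1] at hw
          simp only [Pi.add_apply, add_mul, Finset.sum_add_distrib] at hw
          simpa [Pi.single_apply] using hw
    · rintro (⟨k, ⟨hk, hw⟩, rfl⟩ | ⟨k, ⟨hk, hw⟩, rfl⟩)
      · exact ⟨hk, by simpa [Fin.sum_univ_succ] using hw⟩
      · refine ⟨hk, ?_⟩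
        simp only [Pi.add_apply, add_mul, Finset.sum_add_distrib, hw]
        simp [Pi.single_apply]
  · rw [Set.disjoint_left]
    rintro _ ⟨k, -, rfl⟩ ⟨l, -, h⟩
    simpa using congrFun h 0

/-- The number of elements of given positive weight in a lower set of `ℕ ^ t` is
quasi-polynomial. -/
lemma isQP_ncard_lowerSet (t : ℕ) (d : Fin t → ℕ) (hd : ∀ i, 1 ≤ d i)
    (D : LowerSet (Fin t → ℕ)) :
    IsQP fun n => (({k | k ∈ D ∧ ∑ i, k i * d i = n}.ncard : ℕ) : ℚ) := by
  induction t with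
  | zero =>
    refine IsQP.of_mem (eventually_atTop.2 ⟨1, fun n hn => ?_⟩)
    have : {k | k ∈ D ∧ ∑ i, k i * d i = n} = ∅ := by
      ext k
      simp only [Finset.univ_eq_empty, Finset.sum_empty, Set.mem_ofPred_eq,
        Set.mem_empty_iff_false, iff_false, not_and]
      omega
    simp only [this, Set.ncard_empty, Nat.cast_zero]
  | succ t ih =>
    have := wellFoundedLT_lowerSet (α := Fin (t + 1) → ℕ)
    induction D using WellFoundedLT.induction with
    | ind D ihD =>
    have hle : lowerShift D ≤ D := fun k (hk : k + Pi.single 0 1 ∈ D) =>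
      D.lower le_self_add hk
    have hslice := (isQP_shift_iff (d 0)).2 (ih (fun i => d i.succ) (fun i => hd i.succ)
      (lowerSlice D))
    rcases hle.eq_or_lt with heq | hlt
    · refine IsQP.of_sub (hd 0) (hslice.congr (Eventually.of_forall fun n => ?_))
      rw [ncard_lowerSet_succ hd, heq]
      push_cast
      ring
    · rw [← isQP_shift_iff (d 0)]
      refine (hslice.add (ihD _ hlt)).congr (Eventually.of_forall fun n => ?_)
      rw [ncard_lowerSet_succ hd]
      simp

section Representation

open Pointwise

variable {ι : Type*} {s t : ℕ}

/-- The affine parametrisation of `b j + ⟨h 0, …, h (t - 1)⟩`. -/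
def affineRep (b : Fin s → ι → ℕ) (h : Fin t → ι → ℕ) (j : Fin s) (k : Fin t → ℕ) : ι → ℕ :=
  b j + ∑ i, k i • h i

lemma affineRep_add (b : Fin s → ι → ℕ) (h : Fin t → ι → ℕ) (j : Fin s) (k l : Fin t → ℕ) :
    affineRep b h j (k + l) = affineRep b h j k + ∑ i, l i • h i := by
  simp [affineRep, add_smul, Finset.sum_add_distrib, add_assoc]

/-- The coefficient vectors that are lexicographically first among all representations of the
same element form a lower set. -/
def minimalReps (b : Fin s → ι → ℕ) (h : Fin t → ι → ℕ) (j : Fin s) : LowerSet (Fin t → ℕ) where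
  carrier := {k | ∀ j' k', affineRep b h j' k' = affineRep b h j k →
    ¬ toLex (j', toLex k') < toLex (j, toLex k)}
  lower' := by
    intro l k hkl hl j' k' heq hlt
    refine hl j' (k' + (l - k)) ?_ ?_
    · rw [affineRep_add, heq, ← affineRep_add, add_tsub_cancel_of_le hkl]
    · rw [Prod.Lex.toLex_lt_toLex] at hlt ⊢
      rcases hlt with hlt | ⟨rfl, hlt⟩
      · exact Or.inl hlt
      · refine Or.inr ⟨rfl, ?_⟩
        have h1 : toLex (k' + (l - k)) = toLex k' + toLex (l - k) := rfl
        have h2 : toLex l = toLex k + toLex (l - k) := by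
          rw [← toLex_add, add_tsub_cancel_of_le hkl]
        change toLex (k' + (l - k)) < toLex l
        rw [h1, h2]
        exact add_lt_add_left hlt _

lemma exists_minimalReps (b : Fin s → ι → ℕ) (h : Fin t → ι → ℕ) (j : Fin s) (k : Fin t → ℕ) :
    ∃ j' k', k' ∈ minimalReps b h j' ∧ affineRep b h j' k' = affineRep b h j k := by
  let A : Set (Fin s ×ₗ Lex (Fin t → ℕ)) :=
    {u | affineRep b h (ofLex u).1 (ofLex (ofLex u).2) = affineRep b h j k}
  have hA : A.Nonempty := ⟨toLex (j, toLex k), rfl⟩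
  have hmem := wellFounded_lt.min_mem A hA
  refine ⟨_, _, ?_, hmem⟩
  intro j' k' heq hlt
  exact wellFounded_lt.not_lt_min A (x := toLex (j', toLex k')) (heq.trans hmem) hlt

lemma minimalReps_inj {b : Fin s → ι → ℕ} {h : Fin t → ι → ℕ} {j j' : Fin s} {k k' : Fin t → ℕ}
    (hk : k ∈ minimalReps b h j) (hk' : k' ∈ minimalReps b h j')
    (heq : affineRep b h j k = affineRep b h j' k') : j = j' ∧ k = k' := by
  have h1 : toLex (j, toLex k) = toLex (j', toLex k') :=
    le_antisymm (not_lt.1 (hk _ _ heq.symm)) (not_lt.1 (hk' _ _ heq))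
  simpa using h1

lemma isQP_ncard_affineRep (i0 : ι) (b : Fin s → ι → ℕ) (h : Fin t → ι → ℕ)
    (hd : ∀ i, 1 ≤ h i i0) :
    IsQP fun n => (({x | (∃ j k, affineRep b h j k = x) ∧ x i0 = n}.ncard : ℕ) : ℚ) := by
  have hw : ∀ j k, affineRep b h j k i0 = ∑ i, k i * h i i0 + b j i0 := by
    intro j k
    simp [affineRep, add_comm]
  have hcount : ∀ n, {x | (∃ j k, affineRep b h j k = x) ∧ x i0 = n}.ncard =
      ∑ j, {k | k ∈ minimalReps b h j ∧ ∑ i, k i * h i i0 + b j i0 = n}.ncard := by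
    intro n
    have hfin : ∀ j, {k | k ∈ minimalReps b h j ∧ ∑ i, k i * h i i0 + b j i0 = n}.Finite :=
      fun j => (finite_weight_eq hd (minimalReps b h j) (n - b j i0)).subset
        fun k hk => ⟨hk.1, by have := hk.2; omega⟩
    have := fun j => (hfin j).to_subtype
    simp only [← Nat.card_coe_set_eq]
    rw [← Nat.card_sigma]
    symm
    refine Nat.card_congr (Equiv.ofBijective (fun u => ⟨affineRep b h u.1 u.2.1,
      ⟨_, _, rfl⟩, (hw _ _).trans u.2.2.2⟩) ⟨?_, ?_⟩)
    · rintro ⟨j, k, hk⟩ ⟨j', k', hk'⟩ heq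
      obtain ⟨rfl, rfl⟩ := minimalReps_inj hk.1 hk'.1 (congrArg Subtype.val heq)
      rfl
    · rintro ⟨x, ⟨j, k, rfl⟩, hx⟩
      obtain ⟨j', k', hk', heq⟩ := exists_minimalReps b h j k
      exact ⟨⟨j', k', hk', by rw [← hw, heq, hx]⟩, Subtype.ext heq⟩
  simp only [hcount, Nat.cast_sum]
  refine IsQP.sum _ (fun j n => (({k | k ∈ minimalReps b h j ∧
    ∑ i, k i * h i i0 + b j i0 = n}.ncard : ℕ) : ℚ)) fun j _ => ?_
  rw [← isQP_shift_iff (b j i0)]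
  simpa using isQP_ncard_lowerSet t (fun i => h i i0) hd (minimalReps b h j)

end Representation

section Semilinear

open Pointwise

variable {ι : Type*}

/-- Sets of the form `J + P` with `J` finite and `P` a finitely generated submonoid. -/
def IsFGSet (A : Set (ι → ℕ)) : Prop :=
  ∃ J : Set (ι → ℕ), J.Finite ∧ ∃ P : AddSubmonoid (ι → ℕ), P.FG ∧ A = J + (P : Set (ι → ℕ))

lemma IsFGSet.isQP_ncard {A : Set (ι → ℕ)} (hA : IsFGSet A) (i0 : ι)
    (hfin : ∀ n, {x | x ∈ A ∧ x i0 = n}.Finite) :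
    IsQP fun n => (({x | x ∈ A ∧ x i0 = n}.ncard : ℕ) : ℚ) := by
  classical
  obtain ⟨J, hJ, P, ⟨T, rfl⟩, rfl⟩ := hA
  rcases J.eq_empty_or_nonempty with rfl | ⟨a, ha⟩
  · exact IsQP.of_mem (Eventually.of_forall fun n => by simp)
  let T' := T.erase 0
  have hT' : AddSubmonoid.closure (T' : Set (ι → ℕ)) = AddSubmonoid.closure (T : Set (ι → ℕ)) := by
    refine le_antisymm (AddSubmonoid.closure_mono (by simp [T']))
      (AddSubmonoid.closure_le.2 fun x hx => ?_)
    by_cases h0 : x = 0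
    · rw [h0]
      exact zero_mem _
    · exact AddSubmonoid.subset_closure (by simpa [T', h0] using hx)
  have hpos : ∀ x ∈ T', 1 ≤ x i0 := by
    intro x hx
    rw [Finset.mem_erase] at hx
    by_contra hcon
    refine Set.not_infinite.2 (hfin (a i0)) (Set.infinite_of_injective_forall_mem
      (f := fun m : ℕ => a + m • x) ?_ fun m => ⟨?_, ?_⟩)
    · intro m m' hmm
      obtain ⟨i, hi⟩ := Function.ne_iff.1 hx.1
      have hi' : x i ≠ 0 := hi
      have := congrFun (add_left_cancel hmm) i
      simpa [hi'] using this
    · exact Set.add_mem_add ha (nsmul_mem (AddSubmonoid.subset_closure hx.2) m)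
    · simp [show x i0 = 0 by omega]
  let h : Fin T'.card → ι → ℕ := fun i => (T'.equivFin.symm i : ι → ℕ)
  have hh : Set.range h = (T' : Set (ι → ℕ)) := by
    ext x
    constructor
    · rintro ⟨i, rfl⟩
      exact (T'.equivFin.symm i).2
    · intro hx
      exact ⟨T'.equivFin ⟨x, hx⟩, by simp [h]⟩
  let b : Fin hJ.toFinset.card → ι → ℕ := fun i => (hJ.toFinset.equivFin.symm i : ι → ℕ)
  have hb : Set.range b = J := by
    ext x
    constructor
    · rintro ⟨i, rfl⟩
      exact hJ.mem_toFinset.1 (hJ.toFinset.equivFin.symm i).2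
    · intro hx
      exact ⟨hJ.toFinset.equivFin ⟨x, by simpa using hx⟩, by simp [b]⟩
  have hmem : ∀ x, x ∈ J + (AddSubmonoid.closure (T : Set (ι → ℕ)) : Set (ι → ℕ)) ↔
      ∃ j k, affineRep b h j k = x := by
    intro x
    rw [← hT', ← hh]
    simp only [Set.mem_add, SetLike.mem_coe, AddSubmonoid.mem_closure_range_iff_of_fintype]
    constructor
    · rintro ⟨y, hy, _, ⟨k, rfl⟩, rfl⟩
      rw [← hb] at hy
      obtain ⟨j, rfl⟩ := hy
      exact ⟨j, k, rfl⟩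
    · rintro ⟨j, k, rfl⟩
      exact ⟨b j, hb.subset ⟨j, rfl⟩, _, ⟨k, rfl⟩, rfl⟩
  simp only [hmem]
  exact isQP_ncard_affineRep i0 b h fun i => hpos _ (T'.equivFin.symm i).2

lemma exists_finite_generators_setOf_eq {α M : Type*} [AddCommMonoid α] [PartialOrder α]
    [WellQuasiOrderedLE α] [CanonicallyOrderedAdd α] [AddCommMonoid M] [IsCancelAdd M]
    (a b : M) (f g : α →+ M) :
    ∃ U : Set α, U.Finite ∧ (∀ u ∈ U, a + f u = b + g u) ∧
      ∀ x, a + f x = b + g x → ∃ u ∈ U, ∃ v, f v = g v ∧ x = u + v := by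
  let E : Set α := {x | a + f x = b + g x}
  have hpwo := Set.isPWO_of_wellQuasiOrderedLE E
  refine ⟨{x | Minimal (· ∈ E) x}, (setOfPred_minimal_antichain _).finite_of_partiallyWellOrderedOn
    (hpwo.mono (setOfPred_minimal_subset _)), fun u hu => hu.prop, fun x hx => ?_⟩
  obtain ⟨u, hux, hu⟩ := exists_minimal_le_of_wellFoundedLT (· ∈ E) x hx
  obtain ⟨v, rfl⟩ := exists_add_of_le hux
  refine ⟨u, hu, v, ?_, rfl⟩
  have h1 : a + f u = b + g u := hu.prop
  rw [map_add, map_add, ← add_assoc, ← add_assoc, h1] at hx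
  exact add_left_cancel hx

lemma IsFGSet.inter {A B : Set (ι → ℕ)} (hA : IsFGSet A) (hB : IsFGSet B) : IsFGSet (A ∩ B) := by
  obtain ⟨J, hJ, P, hP, rfl⟩ := hA
  obtain ⟨K, hK, Q, hQ, rfl⟩ := hB
  obtain ⟨p, φ, rfl⟩ := AddSubmonoid.fg_iff_exists_fin_addMonoidHom.1 hP
  obtain ⟨q, ψ, rfl⟩ := AddSubmonoid.fg_iff_exists_fin_addMonoidHom.1 hQ
  let f : (Fin p → ℕ) × (Fin q → ℕ) →+ (ι → ℕ) := φ.comp (AddMonoidHom.fst _ _)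
  let g : (Fin p → ℕ) × (Fin q → ℕ) →+ (ι → ℕ) := ψ.comp (AddMonoidHom.snd _ _)
  choose U hU hUE hgen using fun u : (ι → ℕ) × (ι → ℕ) =>
    exists_finite_generators_setOf_eq u.1 u.2 f g
  refine ⟨⋃ u ∈ J ×ˢ K, (fun v => u.1 + f v) '' U u,
    (hJ.prod hK).biUnion fun u _ => (hU u).image _, (f.eqLocusM g).map f,
    (AddSubmonoid.fg_eqLocusM f g).map f, ?_⟩
  ext x
  constructor
  · rintro ⟨⟨j, hj, _, ⟨k, rfl⟩, rfl⟩, ⟨j', hj', _, ⟨k', rfl⟩, heq⟩⟩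
    obtain ⟨u, hu, v, hv, huv⟩ := hgen (j, j') (k, k') heq.symm
    refine ⟨j + f u, Set.mem_biUnion (x := (j, j')) ⟨hj, hj'⟩ ⟨u, hu, rfl⟩, f v, ⟨v, hv, rfl⟩, ?_⟩
    change j + f u + f v = j + f (k, k')
    rw [huv, map_add, add_assoc]
  · rintro ⟨y, hy, _, ⟨v, hv, rfl⟩, rfl⟩
    obtain ⟨⟨j, j'⟩, ⟨hj, hj'⟩, u, hu, rfl⟩ := Set.mem_iUnion₂.1 hy
    refine ⟨⟨j, hj, f (u + v), ⟨_, rfl⟩, ?_⟩, ⟨j', hj', g (u + v), ⟨_, rfl⟩, ?_⟩⟩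
    · simp [add_assoc]
    · have h1 : j + f u = j' + g u := hUE (j, j') u hu
      have h2 : f v = g v := hv
      change j' + g (u + v) = j + f u + f v
      rw [map_add, h1, h2, add_assoc]

lemma isQP_ncard_list (i0 : ι) (l : List (Set (ι → ℕ))) (hl : ∀ A ∈ l, IsFGSet A)
    (hfin : ∀ n, {x | (∃ A ∈ l, x ∈ A) ∧ x i0 = n}.Finite) :
    IsQP fun n => (({x | (∃ A ∈ l, x ∈ A) ∧ x i0 = n}.ncard : ℕ) : ℚ) := by
  induction hm : l.length generalizing l with
  | zero =>
    obtain rfl := List.length_eq_zero_iff.1 hm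
    exact IsQP.of_mem (Eventually.of_forall fun n => by simp)
  | succ m ih =>
    obtain ⟨B, l, rfl⟩ := List.exists_cons_of_length_eq_add_one hm
    have hfinB : ∀ n, {x | x ∈ B ∧ x i0 = n}.Finite := fun n =>
      (hfin n).subset fun x hx => ⟨⟨B, by simp, hx.1⟩, hx.2⟩
    have hfinl : ∀ n, {x | (∃ A ∈ l, x ∈ A) ∧ x i0 = n}.Finite := fun n =>
      (hfin n).subset fun x ⟨⟨A, hA, hx⟩, hn⟩ => ⟨⟨A, by simp [hA], hx⟩, hn⟩
    have hmap : ∀ x, (∃ A ∈ l.map (· ∩ B), x ∈ A) ↔ (∃ A ∈ l, x ∈ A) ∧ x ∈ B := by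
      intro x
      simp only [List.mem_map, exists_exists_and_eq_and, Set.mem_inter_iff]
      tauto
    have hB := (hl B (by simp)).isQP_ncard i0 hfinB
    have hl1 := ih l (fun A hA => hl A (by simp [hA])) hfinl (by simpa using hm)
    have hl2 := ih (l.map (· ∩ B)) (by
      intro A hA
      obtain ⟨A', hA', rfl⟩ := List.mem_map.1 hA
      exact (hl A' (by simp [hA'])).inter (hl B (by simp)))
      (fun n => (hfinB n).subset fun x hx => ⟨((hmap x).1 hx.1).2, hx.2⟩) (by simpa using hm)
    refine ((hB.add hl1).add hl2.neg).congr (Eventually.of_forall fun n => ?_)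
    have key := Set.ncard_union_add_ncard_inter {x | x ∈ B ∧ x i0 = n}
      {x | (∃ A ∈ l, x ∈ A) ∧ x i0 = n} (hfinB n) (hfinl n)
    have h1 : {x | x ∈ B ∧ x i0 = n} ∪ {x | (∃ A ∈ l, x ∈ A) ∧ x i0 = n} =
        {x | (∃ A ∈ B :: l, x ∈ A) ∧ x i0 = n} := by
      ext x
      simp only [Set.mem_union, Set.mem_ofPred_eq, List.exists_mem_cons_iff]
      tauto
    have h2 : {x | x ∈ B ∧ x i0 = n} ∩ {x | (∃ A ∈ l, x ∈ A) ∧ x i0 = n} =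
        {x | (∃ A ∈ l.map (· ∩ B), x ∈ A) ∧ x i0 = n} := by
      ext x
      simp only [Set.mem_inter_iff, Set.mem_ofPred_eq, hmap]
      tauto
    rw [h1, h2] at key
    have key' : (({x | (∃ A ∈ B :: l, x ∈ A) ∧ x i0 = n}.ncard : ℕ) : ℚ) +
        ({x | (∃ A ∈ l.map (· ∩ B), x ∈ A) ∧ x i0 = n}.ncard : ℕ) =
        ({x | x ∈ B ∧ x i0 = n}.ncard : ℕ) + ({x | (∃ A ∈ l, x ∈ A) ∧ x i0 = n}.ncard : ℕ) := by
      exact_mod_cast key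
    simp only [Pi.add_apply, Pi.neg_apply]
    linarith

/-- A semilinear set with finite fibres over one coordinate has quasi-polynomial fibre
cardinalities. -/
lemma isQP_ncard_semilinear (i0 : ι) {G : Set (ι → ℕ)} (hG : IsSemilinearSet G)
    (hfin : ∀ n, {x | x ∈ G ∧ x i0 = n}.Finite) :
    IsQP fun n => (({x | x ∈ G ∧ x i0 = n}.ncard : ℕ) : ℚ) := by
  obtain ⟨S, hS, rfl⟩ := isSemilinearSet_iff.1 hG
  have hmem : ∀ x, x ∈ ⋃₀ (S : Set (Set (ι → ℕ))) ↔ ∃ A ∈ S.toList, x ∈ A := by simp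
  simp only [hmem] at hfin ⊢
  refine isQP_ncard_list i0 S.toList (fun A hA => ?_) hfin
  obtain ⟨a, t, ht, rfl⟩ := hS A (by simpa using hA)
  exact ⟨{a}, Set.finite_singleton a, AddSubmonoid.closure t,
    AddSubmonoid.fg_iff _ |>.2 ⟨t, rfl, ht⟩, by rw [Set.singleton_add]; rfl⟩

end Semilinear

section DigitBox

open Pointwise

variable {ι : Type*}

/-- Affine functions `ℕ^ι → ℤ`. -/
def IsAffine (L : (ι → ℕ) → ℤ) : Prop :=
  ∃ (b : ℤ) (f : (ι → ℕ) →+ ℤ), ∀ x, L x = b + f x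

lemma IsAffine.add {L L' : (ι → ℕ) → ℤ} (h : IsAffine L) (h' : IsAffine L') :
    IsAffine fun x => L x + L' x := by
  obtain ⟨b, f, hf⟩ := h
  obtain ⟨b', f', hf'⟩ := h'
  exact ⟨b + b', f + f', fun x => by simp only [hf, hf', AddMonoidHom.add_apply]; ring⟩

lemma isAffine_const (b : ℤ) : IsAffine fun _ : ι → ℕ => b :=
  ⟨b, 0, fun x => by simp⟩

lemma IsAffine.const_mul {L : (ι → ℕ) → ℤ} (h : IsAffine L) (c : ℤ) :
    IsAffine fun x => c * L x := by
  obtain ⟨b, f, hf⟩ := h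
  exact ⟨c * b, (AddMonoidHom.mulLeft c).comp f, fun x => by simp [hf, mul_add]⟩

/-- The `i`-th coordinate as a homomorphism to `ℤ`. -/
def coord (i : ι) : (ι → ℕ) →+ ℤ :=
  (Nat.castAddMonoidHom ℤ).comp (Pi.evalAddMonoidHom (fun _ => ℕ) i)

@[simp]
lemma coord_apply (i : ι) (x : ι → ℕ) : coord i x = x i := rfl

lemma isAffine_coord (i : ι) : IsAffine fun x : ι → ℕ => (x i : ℤ) :=
  ⟨0, coord i, fun x => by simp⟩

/-- Vectors whose coordinates other than `i0` are digits in base `x i0`. -/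
def digitBox (i0 : ι) : Set (ι → ℕ) :=
  {x | 0 < x i0 ∧ ∀ i, i ≠ i0 → x i < x i0}

lemma isSemilinearSet_one_le [Finite ι] (f : (ι → ℕ) →+ ℤ) : IsSemilinearSet {x | 1 ≤ f x} := by
  have h : IsSemilinearSet {z : ℤ | 1 ≤ z} := by
    have := (IsSemilinearSet.closure_finset ({1} : Finset ℤ)).vadd 1
    convert this using 1
    ext z
    simp only [Set.mem_ofPred_eq, Finset.coe_singleton, Set.mem_vadd_set, SetLike.mem_coe,
      AddSubmonoid.mem_closure_singleton]
    constructor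
    · intro hz
      exact ⟨z - 1, ⟨(z - 1).toNat, by simp; omega⟩, by simp⟩
    · rintro ⟨_, ⟨m, rfl⟩, rfl⟩
      simp
  exact h.preimage f

lemma isSemilinearSet_digitBox [Finite ι] (i0 : ι) : IsSemilinearSet (digitBox i0) := by
  have h : digitBox i0 = {x | 1 ≤ coord i0 x} ∩
      ⋂ i : {i // i ≠ i0}, {x | 1 ≤ (coord i0 - coord i.1) x} := by
    ext x
    simp only [digitBox, Set.mem_ofPred_eq, Set.mem_inter_iff, Set.mem_iInter, coord_apply,
      AddMonoidHom.sub_apply, Subtype.forall]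
    refine and_congr (by omega) (forall_congr' fun i => forall_congr' fun _ => by omega)
  rw [h]
  exact (isSemilinearSet_one_le _).inter (IsSemilinearSet.iInter fun i => isSemilinearSet_one_le _)

lemma IsAffine.exists_bound [Finite ι] {L : (ι → ℕ) → ℤ} (h : IsAffine L) (i0 : ι) :
    ∃ C : ℤ, ∀ x ∈ digitBox i0, |L x| ≤ C * x i0 := by
  classical
  have := Fintype.ofFinite ι
  obtain ⟨b, f, hf⟩ := h
  refine ⟨|b| + ∑ i, |f (Pi.single i 1)|, fun x hx => ?_⟩
  have hle : ∀ i, (x i : ℤ) ≤ x i0 := fun i => by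
    by_cases hi : i = i0
    · rw [hi]
    · exact_mod_cast (hx.2 i hi).le
  have hpos : (1 : ℤ) ≤ x i0 := by exact_mod_cast hx.1
  have hfx : f x = ∑ i, x i * f (Pi.single i 1) := by
    conv_lhs => rw [← Finset.univ_sum_single x]
    rw [map_sum]
    refine Finset.sum_congr rfl fun i _ => ?_
    rw [← nsmul_eq_mul, ← map_nsmul, ← Pi.single_smul', smul_eq_mul, mul_one]
  rw [hf, hfx, add_mul, Finset.sum_mul]
  refine (abs_add_le _ _).trans (add_le_add ?_ ((Finset.abs_sum_le_sum_abs _ _).trans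
    (Finset.sum_le_sum fun i _ => ?_)))
  · exact le_mul_of_one_le_right (abs_nonneg b) hpos
  · rw [abs_mul, mul_comm, Nat.abs_cast]
    exact mul_le_mul_of_nonneg_left (hle i) (abs_nonneg _)

/-- Polynomials in the coordinate `i0` whose coefficients are affine functions. -/
inductive IsPolyAffine (i0 : ι) : ((ι → ℕ) → ℤ) → Prop
  | affine {L} (h : IsAffine L) : IsPolyAffine i0 L
  | step {L L'} (h : IsAffine L) (h' : IsPolyAffine i0 L') :
    IsPolyAffine i0 fun x => L x + x i0 * L' x

variable {i0 : ι}

lemma IsPolyAffine.add {L L' : (ι → ℕ) → ℤ} (h : IsPolyAffine i0 L) (h' : IsPolyAffine i0 L') :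
    IsPolyAffine i0 fun x => L x + L' x := by
  induction h generalizing L' with
  | affine h =>
    cases h' with
    | affine h' => exact .affine (h.add h')
    | step h' h'' => simpa only [add_assoc] using IsPolyAffine.step (h.add h') h''
  | @step L L₁ h h₁ ih =>
    cases h' with
    | affine h' =>
      simpa only [add_right_comm] using IsPolyAffine.step (h.add h') h₁
    | @step L' L₁' h' h₁' =>
      have := IsPolyAffine.step (h.add h') (ih h₁')
      convert this using 2
      ring

lemma IsPolyAffine.const_mul {L : (ι → ℕ) → ℤ} (h : IsPolyAffine i0 L) (c : ℤ) :
    IsPolyAffine i0 fun x => c * L x := by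
  induction h with
  | affine h => exact .affine (h.const_mul c)
  | step h _ ih =>
    have := IsPolyAffine.step (h.const_mul c) ih
    convert this using 2
    ring

lemma IsPolyAffine.mul_pow {L : (ι → ℕ) → ℤ} (h : IsPolyAffine i0 L) (m : ℕ) :
    IsPolyAffine i0 fun x => L x * (x i0 : ℤ) ^ m := by
  induction m with
  | zero => simpa using h
  | succ m ih =>
    have := IsPolyAffine.step (isAffine_const 0) ih
    convert this using 2
    ring

lemma IsPolyAffine.sum {α : Type*} (s : Finset α) (L : α → (ι → ℕ) → ℤ)
    (h : ∀ a ∈ s, IsPolyAffine i0 (L a)) : IsPolyAffine i0 fun x => ∑ a ∈ s, L a x := by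
  classical
  induction s using Finset.induction_on with
  | empty => exact .affine (by simpa using isAffine_const 0)
  | insert a s ha ih =>
    simp only [Finset.sum_insert ha]
    exact (h a (by simp)).add (ih fun b hb => h b (by simp [hb]))

lemma IsPolyAffine.mul_eval {L : (ι → ℕ) → ℤ} (h : IsPolyAffine i0 L) (p : ℤ[X]) :
    IsPolyAffine i0 fun x => p.eval (x i0 : ℤ) * L x := by
  simp only [eval_eq_sum_range, Finset.sum_mul]
  refine IsPolyAffine.sum _ _ fun m _ => ?_
  have := (h.const_mul (p.coeff m)).mul_pow m
  convert this using 2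
  ring

lemma IsPolyAffine.isSemilinearSet_add_eq_zero [Finite ι] {L : (ι → ℕ) → ℤ}
    (h : IsPolyAffine i0 L) (c : ℤ) : IsSemilinearSet {x | x ∈ digitBox i0 ∧ c + L x = 0} := by
  have haff : ∀ L : (ι → ℕ) → ℤ, IsAffine L → IsSemilinearSet {x | L x = 0} := by
    rintro L ⟨b, f, hf⟩
    simpa [hf] using isSemilinearSet_setOfPred_eq b 0 f (0 : (ι → ℕ) →+ ℤ)
  induction h generalizing c with
  | @affine L h => exact (isSemilinearSet_digitBox i0).inter (haff _ ((isAffine_const c).add h))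
  | @step L L' h h' ih =>
    have hc := (isAffine_const c).add h
    obtain ⟨C, hC⟩ := hc.exists_bound i0
    have heq : {x | x ∈ digitBox i0 ∧ c + (L x + x i0 * L' x) = 0} =
        ⋃ q ∈ Finset.Icc (-C) C, {x | (c + L x) + -q * x i0 = 0} ∩
          {x | x ∈ digitBox i0 ∧ q + L' x = 0} := by
      ext x
      simp only [Set.mem_iUnion, Set.mem_inter_iff, Set.mem_ofPred_eq, Finset.mem_Icc, exists_prop]
      constructor
      · rintro ⟨hx, h0⟩
        have hb := abs_le.1 (hC x hx)
        have hpos : (0 : ℤ) < x i0 := by exact_mod_cast hx.1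
        have hval : c + L x = -L' x * x i0 := by linarith
        rw [hval] at hb
        refine ⟨-L' x, ⟨?_, ?_⟩, by linarith, hx, by ring⟩
        · exact le_of_mul_le_mul_right (by linarith [hb.1]) hpos
        · exact le_of_mul_le_mul_right hb.2 hpos
      · rintro ⟨q, -, h1, hx, h2⟩
        refine ⟨hx, ?_⟩
        obtain rfl : q = -L' x := by linarith
        linarith
    rw [heq]
    exact IsSemilinearSet.biUnion_finset fun q _ =>
      (haff _ (hc.add ((isAffine_coord i0).const_mul (-q)))).inter (ih q)

end DigitBox

section Semigroup

/-- Evaluation of digit vectors in base `n`. -/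
def ofDigitVec {d : ℕ} (n : ℕ) (c : Fin d → ℕ) : ℕ := ∑ j, c j * n ^ (j : ℕ)

lemma bijOn_ofDigitVec (d n : ℕ) :
    Set.BijOn (ofDigitVec (d := d) n) {c | ∀ j, c j < n} (Set.Iio (n ^ d)) := by
  have happ : ∀ (c : Fin d → ℕ) (hc : ∀ j, c j < n),
      ofDigitVec n c = finFunctionFinEquiv fun j => (⟨c j, hc j⟩ : Fin n) := by
    intro c hc
    rw [finFunctionFinEquiv_apply]
    rfl
  refine ⟨fun c hc => ?_, fun c hc c' hc' heq => ?_, fun y hy => ?_⟩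
  · rw [happ c hc]
    exact Fin.is_lt _
  · rw [happ c hc, happ c' hc', Fin.val_inj, finFunctionFinEquiv.injective.eq_iff] at heq
    funext j
    exact congrArg Fin.val (congrFun heq j)
  · refine ⟨fun j => finFunctionFinEquiv.symm ⟨y, hy⟩ j, fun j => Fin.is_lt _, ?_⟩
    rw [happ _ fun j => Fin.is_lt _]
    exact congrArg Fin.val (finFunctionFinEquiv.apply_symm_apply ⟨y, hy⟩)

lemma exists_coeff_le {k : ℕ} (v : Fin k → ℕ) {y : ℕ}
    (hy : y ∈ AddSubmonoid.closure (Set.range v)) :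
    ∃ a : Fin k → ℕ, (∀ i, a i ≤ y) ∧ y = ∑ i, a i * v i := by
  obtain ⟨a, rfl⟩ := AddSubmonoid.mem_closure_range_iff_of_fintype.1 hy
  refine ⟨fun i => if v i = 0 then 0 else a i, fun i => ?_, Finset.sum_congr rfl fun i _ => ?_⟩
  · dsimp only
    split_ifs with h
    · exact Nat.zero_le _
    · exact (Nat.le_mul_of_pos_right _ (Nat.pos_of_ne_zero h)).trans
        (Finset.single_le_sum (f := fun i => a i • v i) (fun _ _ => Nat.zero_le _)
          (Finset.mem_univ i))
  · dsimp only
    split_ifs with h <;> simp [h]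

variable {k : ℕ} {f : Fin k → ℕ → ℕ} {p : Fin k → ℤ[X]}

/-- The digit vectors, with their base as coordinate `none`, of elements of the semigroup. -/
def semigroupDigits (p : Fin k → ℤ[X]) (d : ℕ) : Set (Option (Fin d) → ℕ) :=
  {x | ∃ a : Fin k × Fin d → ℕ, Sum.elim x a ∈ digitBox (Sum.inl none) ∧
    (ofDigitVec (x none) (fun j => x (some j)) : ℤ) =
      ∑ i, (p i).eval (x none : ℤ) * ofDigitVec (x none) fun j => a (i, j)}

lemma isSemilinearSet_semigroupDigits (p : Fin k → ℤ[X]) (d : ℕ) :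
    IsSemilinearSet (semigroupDigits p d) := by
  let i0 : Option (Fin d) ⊕ (Fin k × Fin d) := Sum.inl none
  have hdig : ∀ u : Fin d → Option (Fin d) ⊕ (Fin k × Fin d),
      IsPolyAffine i0 fun z => (ofDigitVec (z i0) (fun j => z (u j)) : ℤ) := by
    intro u
    simp only [ofDigitVec, Nat.cast_sum, Nat.cast_mul, Nat.cast_pow]
    exact IsPolyAffine.sum _ _ fun j _ => (IsPolyAffine.affine (isAffine_coord (u j))).mul_pow j
  have hL := (hdig fun j => Sum.inl (some j)).add ((IsPolyAffine.sum Finset.univ _ fun i _ =>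
    (hdig fun j => Sum.inr (i, j)).mul_eval (p i)).const_mul (-1))
  convert (hL.isSemilinearSet_add_eq_zero 0).proj using 1
  ext x
  refine exists_congr fun a => and_congr_right fun _ => ?_
  simp only [i0, Sum.elim_inl, Sum.elim_inr]
  constructor <;> intro h <;> linarith

lemma mem_semigroupDigits (hp : ∀ i, ∀ n : ℕ, (f i n : ℤ) = (p i).eval (n : ℤ)) {d : ℕ}
    {x : Option (Fin d) → ℕ} (hx : x ∈ digitBox none) :
    x ∈ semigroupDigits p d ↔ ofDigitVec (x none) (fun j => x (some j)) ∈ SG k f (x none) := by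
  have hcast : ∀ a : Fin k × Fin d → ℕ, ((ofDigitVec (x none) (fun j => x (some j)) : ℤ) =
      ∑ i, (p i).eval (x none : ℤ) * ofDigitVec (x none) fun j => a (i, j)) ↔
      ofDigitVec (x none) (fun j => x (some j)) =
        ∑ i, (ofDigitVec (x none) fun j => a (i, j)) * f i (x none) := by
    intro a
    simp only [← hp, mul_comm (ofDigitVec (x none) fun j => a _)]
    norm_cast
  constructor
  · rintro ⟨a, -, ha⟩
    exact AddSubmonoid.mem_closure_range_iff_of_fintype.2 ⟨_, (hcast a).1 ha⟩
  · intro h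
    obtain ⟨a, hle, ha⟩ := exists_coeff_le _ h
    have hlt : ofDigitVec (x none) (fun j => x (some j)) < x none ^ d :=
      (bijOn_ofDigitVec d (x none)).mapsTo fun j => hx.2 (some j) (by simp)
    have hdig : ∀ i, ∃ b : Fin d → ℕ, (∀ j, b j < x none) ∧ ofDigitVec (x none) b = a i :=
      fun i => (bijOn_ofDigitVec d (x none)).surjOn (Set.mem_Iio.2 ((hle i).trans_lt hlt))
    choose b hb hab using hdig
    let c : Fin k × Fin d → ℕ := fun u => b u.1 u.2
    have hc : Sum.elim x c ∈ digitBox (Sum.inl none) := by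
      refine ⟨hx.1, ?_⟩
      rintro ((_ | j) | u) hi
      · exact absurd rfl hi
      · exact hx.2 _ (by simp)
      · exact hb u.1 u.2
    refine ⟨c, hc, (hcast c).2 ?_⟩
    simpa only [c, hab] using ha

lemma isQP_ncard_gaps_lt (hp : ∀ i, ∀ n : ℕ, (f i n : ℤ) = (p i).eval (n : ℤ)) (d : ℕ) :
    IsQP fun n => (({y | y < n ^ d ∧ y ∉ SG k f n}.ncard : ℕ) : ℚ) := by
  let G : Set (Option (Fin d) → ℕ) := digitBox none \ semigroupDigits p d
  have hG : IsSemilinearSet G :=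
    (isSemilinearSet_digitBox none).sdiff (isSemilinearSet_semigroupDigits p d)
  let val : (Option (Fin d) → ℕ) → ℕ := fun x => ofDigitVec (x none) fun j => x (some j)
  have hinj : ∀ n, Set.InjOn val {x | x ∈ G ∧ x none = n} := by
    rintro n x ⟨hx, hxn⟩ y ⟨hy, hyn⟩ heq
    have hxd : ∀ j, x (some j) < n := fun j => hxn ▸ hx.1.2 (some j) (by simp)
    have hyd : ∀ j, y (some j) < n := fun j => hyn ▸ hy.1.2 (some j) (by simp)
    simp only [val, hxn, hyn] at heq
    have := (bijOn_ofDigitVec d n).injOn hxd hyd heq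
    funext j
    cases j with
    | none => rw [hxn, hyn]
    | some j => exact congrFun this j
  have hmaps : ∀ n, Set.MapsTo val {x | x ∈ G ∧ x none = n} {y | y < n ^ d ∧ y ∉ SG k f n} := by
    rintro _ x ⟨hx, rfl⟩
    exact ⟨(bijOn_ofDigitVec d _).mapsTo fun j => hx.1.2 (some j) (by simp),
      fun h => hx.2 ((mem_semigroupDigits hp hx.1).2 h)⟩
  have hsurj : ∀ n, 1 ≤ n →
      Set.SurjOn val {x | x ∈ G ∧ x none = n} {y | y < n ^ d ∧ y ∉ SG k f n} := by
    rintro n hn y ⟨hy, hyS⟩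
    obtain ⟨c, hc, rfl⟩ := (bijOn_ofDigitVec d n).surjOn hy
    let x : Option (Fin d) → ℕ := fun j => j.elim n c
    have hx : x ∈ digitBox none := by
      refine ⟨hn, fun j hj => ?_⟩
      cases j with
      | none => exact absurd rfl hj
      | some j => exact hc j
    exact ⟨x, ⟨⟨hx, fun h => hyS ((mem_semigroupDigits hp hx).1 h)⟩, rfl⟩, rfl⟩
  have hfin : ∀ n, {x | x ∈ G ∧ x none = n}.Finite := fun n =>
    Set.Finite.of_injOn (hmaps n) (hinj n) ((Set.finite_Iio (n ^ d)).subset fun y hy => hy.1)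
  refine (isQP_ncard_semilinear none hG hfin).congr ?_
  filter_upwards [eventually_ge_atTop 1] with n hn
  rw [← Set.BijOn.image_eq ⟨hmaps n, hinj n, hsurj n hn⟩, (hinj n).ncard_image]

end Semigroup

section Bound

/-- Explicit bound on the largest gap of a numerical semigroup. -/
lemma mem_closure_of_le {k : ℕ} (v : Fin k → ℕ)
    (hfin : ((AddSubmonoid.closure (Set.range v) : Set ℕ)ᶜ).Finite) {y : ℕ}
    (hy : (∑ i, v i) * ∑ i, v i ≤ y) : y ∈ AddSubmonoid.closure (Set.range v) := by
  obtain ⟨N, hN⟩ := hfin.bddAbove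
  have hN' : ∀ z, N < z → z ∈ AddSubmonoid.closure (Set.range v) := fun z hz => by
    by_contra h
    exact absurd (hN h) (by omega)
  have hle : ∀ i, v i ≤ ∑ i, v i := fun i =>
    Finset.single_le_sum (f := v) (fun _ _ => Nat.zero_le _) (Finset.mem_univ i)
  obtain ⟨i, hi⟩ : ∃ i, 0 < v i := by
    by_contra! h
    obtain ⟨a, ha⟩ := AddSubmonoid.mem_closure_range_iff_of_fintype.1 (hN' (N + 1) (by omega))
    have h0 : ∀ i, v i = 0 := fun i => Nat.le_zero.1 (h i)
    simp [h0] at ha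
  obtain ⟨a, ha⟩ := AddSubmonoid.mem_closure_range_iff_of_fintype.1
    (hN' (y + (N + 1) * v i) (by nlinarith))
  let z := ∑ j, (a j % v i) • v j
  have hz : z ∈ AddSubmonoid.closure (Set.range v) :=
    AddSubmonoid.mem_closure_range_iff_of_fintype.2 ⟨_, rfl⟩
  have hzy : z ≤ y := by
    refine le_trans ?_ hy
    rw [Finset.mul_sum]
    exact Finset.sum_le_sum fun j _ => Nat.mul_le_mul_right _ ((Nat.mod_lt _ hi).le.trans (hle i))
  have hmod : z ≡ y [MOD v i] := by
    have h1 : y + (N + 1) * v i ≡ y [MOD v i] := by simp [Nat.ModEq]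
    refine Nat.ModEq.trans ?_ h1
    rw [ha]
    exact Nat.ModEq.sum fun j _ => (Nat.mod_modEq _ _).mul_right _
  obtain ⟨m, hm⟩ := (Nat.modEq_iff_dvd' hzy).1 hmod
  have hyz : y = z + m • v i := by
    rw [smul_eq_mul, mul_comm, ← hm]
    omega
  rw [hyz]
  exact add_mem hz (nsmul_mem (AddSubmonoid.subset_closure (Set.mem_range_self i)) m)

lemma exists_eval_le_pow (p : ℤ[X]) :
    ∃ d : ℕ, ∀ᶠ n : ℕ in atTop, p.eval (n : ℤ) ≤ (n : ℤ) ^ d := by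
  induction p using Polynomial.induction_on' with
  | add p q hp hq =>
    obtain ⟨d, hd⟩ := hp
    obtain ⟨e, he⟩ := hq
    refine ⟨max d e + 1, ?_⟩
    filter_upwards [hd, he, eventually_ge_atTop 2] with n h1 h2 hn
    have hn' : (2 : ℤ) ≤ n := by exact_mod_cast hn
    have h3 : (n : ℤ) ^ d ≤ n ^ max d e := pow_le_pow_right₀ (by omega) (le_max_left _ _)
    have h4 : (n : ℤ) ^ e ≤ n ^ max d e := pow_le_pow_right₀ (by omega) (le_max_right _ _)
    have h5 : (2 : ℤ) * n ^ max d e ≤ n * n ^ max d e :=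
      mul_le_mul_of_nonneg_right hn' (by positivity)
    rw [eval_add, pow_succ']
    linarith
  | monomial m c =>
    refine ⟨m + 1, ?_⟩
    filter_upwards [eventually_ge_atTop c.toNat] with n hn
    have hc : c ≤ n := by omega
    rw [eval_monomial, pow_succ']
    exact mul_le_mul_of_nonneg_right hc (by positivity)

end Bound

end QuasiPoly

theorem stmt2 (k : ℕ) (hk : 1 ≤ k) (f : Fin k → ℕ → ℕ)
    (hf : ∀ i, ∃ p : Polynomial ℤ, ∀ n : ℕ, (f i n : ℤ) = p.eval (n : ℤ)) :
    ∃ g : ℕ → ℤ, IsEQP g ∧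
      ∀ n : ℕ, ((SG k f n : Set ℕ)ᶜ).Finite →
        g n = (((SG k f n : Set ℕ)ᶜ).ncard : ℤ) := by
  choose p hp using hf
  obtain ⟨d, hd⟩ := QuasiPoly.exists_eval_le_pow ((∑ i, p i) * ∑ i, p i)
  obtain ⟨N, hN⟩ := Filter.eventually_atTop.1 hd
  have hbound : ∀ n, N ≤ n → (∑ i, f i n) * ∑ i, f i n ≤ n ^ d := by
    intro n hn
    have h := hN n hn
    simp only [Polynomial.eval_mul, Polynomial.eval_finsetSum, ← hp] at h
    exact_mod_cast h
  refine ⟨fun n => if N ≤ n then ({y | y < n ^ d ∧ y ∉ SG k f n}.ncard : ℤ)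
    else (((SG k f n : Set ℕ)ᶜ).ncard : ℤ), ?_, fun n hfin => ?_⟩
  · refine QuasiPoly.IsQP.isEQP ((QuasiPoly.isQP_ncard_gaps_lt hp d).congr ?_)
    filter_upwards [Filter.eventually_ge_atTop N] with n hn
    simp [hn]
  · dsimp only
    split_ifs with hn
    · congr 2
      ext y
      refine ⟨fun h => h.2, fun h => ⟨?_, h⟩⟩
      by_contra hlt
      exact h (QuasiPoly.mem_closure_of_le _ hfin ((hbound n hn).trans (not_lt.1 hlt)))
    · rfl
end

section
/- Let f_1, …, f_k : ℕ → ℕ be functions given by polynomials with integer coefficients, and for each n let S_n ⊆ ℕ be the additive submonoid generated by f_1(n), …, f_k(n). Then there is an eventually quasi-polynomial function g : ℕ → ℤ such that for every n for which ℕ \ S_n is finite and nonempty, the Frobenius number max(ℕ \ S_n) equals g(n). -/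
open Polynomial

/-- The set of pairs `(m, v)` with `m ≥ 2` and all entries of `v` base-`m` digits. -/
def digitBox (ι : Type*) : Set (ℕ × (ι → ℕ)) := {v | 2 ≤ v.1 ∧ ∀ i, v.2 i < v.1}

theorem isSemilinearSet_setOf_le {M : Type*} [AddCommMonoid M] [AddMonoid.FG M]
    (a b : ℕ) (f g : M →+ ℕ) : IsSemilinearSet {x | a + f x ≤ b + g x} := by
  have h := (isSemilinearSet_setOfPred_eq (M := M × ℕ) a b
    (f.comp (AddMonoidHom.fst M ℕ) + AddMonoidHom.snd M ℕ)
    (g.comp (AddMonoidHom.fst M ℕ))).image (AddMonoidHom.fst M ℕ)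
  convert! h using 1
  ext x
  simp only [Set.mem_image, Prod.exists]
  constructor
  · intro hx
    obtain ⟨c, hc⟩ := Nat.exists_eq_add_of_le hx
    exact ⟨x, c, by simpa [add_assoc] using hc.symm, rfl⟩
  · rintro ⟨y, c, hy, rfl⟩
    simp only [Set.mem_ofPred_eq] at hy ⊢
    simp at hy ⊢
    omega

theorem isSemilinearSet_digitBox (ι : Type*) [Finite ι] : IsSemilinearSet (digitBox ι) := by
  have h₁ := isSemilinearSet_setOf_le 2 0 0 (AddMonoidHom.fst ℕ (ι → ℕ))
  have h₂ := IsSemilinearSet.iInter fun i : ι => isSemilinearSet_setOf_le 1 0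
    ((Pi.evalAddMonoidHom (fun _ => ℕ) i).comp (AddMonoidHom.snd ℕ (ι → ℕ)))
    (AddMonoidHom.fst ℕ (ι → ℕ))
  convert! h₁.inter h₂ using 1
  ext v
  simp [digitBox, Nat.lt_iff_add_one_le, add_comm]

/-- A vanishing base-`m` combination has bounded carries. -/
theorem exists_carries {m C : ℤ} (hm : 2 ≤ m) (D : ℕ) (G : ℕ → ℤ) (e : ℤ)
    (he : |e| ≤ 2 * C) (hG : ∀ j, |G j| ≤ C * m)
    (h : e + ∑ j ∈ Finset.range D, G j * m ^ j = 0) :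
    ∃ c : ℕ → ℤ, c 0 = e ∧ c D = 0 ∧ (∀ j, |c j| ≤ 2 * C) ∧
      ∀ j < D, c j + G j = m * c (j + 1) := by
  induction D generalizing G e with
  | zero => exact ⟨fun _ => e, rfl, by simpa using h, fun _ => he, by simp⟩
  | succ D ih =>
    rw [Finset.sum_range_succ'] at h
    simp only [pow_succ, ← mul_assoc, ← Finset.sum_mul] at h
    obtain ⟨e', rfl⟩ : ∃ e', e = m * e' - G 0 :=
      ⟨-∑ j ∈ Finset.range D, G (j + 1) * m ^ j, by linarith⟩
    have hm0 : m ≠ 0 := by omega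
    have he' : |e'| ≤ 2 * C := by
      have h1 : |m * e'| ≤ 2 * C + C * m := by
        calc |m * e'| = |(m * e' - G 0) + G 0| := by ring_nf
          _ ≤ _ := (abs_add_le _ _).trans (add_le_add he (hG 0))
      rw [abs_mul, abs_of_pos (by omega)] at h1
      have hC : 0 ≤ C := by have := abs_nonneg (m * e' - G 0); omega
      nlinarith
    obtain ⟨c, hc0, hcD, hcb, hc⟩ := ih (fun j => G (j + 1)) e' he' (fun j => hG _) (by
      have : m * (e' + ∑ j ∈ Finset.range D, G (j + 1) * m ^ j) = 0 := by linarith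
      simpa [hm0] using this)
    refine ⟨fun j => Nat.casesOn j (m * e' - G 0) c, rfl, hcD, ?_, ?_⟩
    · rintro (_ | j)
      · exact he
      · exact hcb j
    · rintro (_ | j) hj
      · simp [hc0]
      · exact hc j (by omega)

theorem sum_range_mul_pow_of_carries {m : ℤ} (D : ℕ) (G c : ℕ → ℤ)
    (h : ∀ j < D, c j + G j = m * c (j + 1)) :
    c 0 + ∑ j ∈ Finset.range D, G j * m ^ j = c D * m ^ D := by
  induction D with
  | zero => simp
  | succ D ih =>
    rw [Finset.sum_range_succ, ← add_assoc, ih fun j hj => h j (by omega), pow_succ]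
    linear_combination m ^ D * h D (by omega)

/-- On base-`m` digits, a linear equation whose coefficients are integer polynomials in `m`
cuts out a semilinear set. -/
theorem isSemilinearSet_polynomial_eq {ι : Type*} [Fintype ι] (P : ι → ℤ[X]) (Q : ℤ[X]) :
    IsSemilinearSet {v : ℕ × (ι → ℕ) | v ∈ digitBox ι ∧
      ∑ i, (P i).eval (v.1 : ℤ) * v.2 i + Q.eval (v.1 : ℤ) = 0} := by
  obtain ⟨D, hP, hQ⟩ : ∃ D, (∀ i, (P i).natDegree < D) ∧ Q.natDegree < D := by
    refine ⟨∑ i, (P i).natDegree + Q.natDegree + 1, fun i => ?_, by omega⟩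
    have := Finset.single_le_sum (f := fun i => (P i).natDegree) (fun _ _ => Nat.zero_le _)
      (Finset.mem_univ i)
    omega
  let L (j : ℕ) : ℕ × (ι → ℕ) →+ ℤ :=
    ∑ i, (P i).coeff j • (Nat.castAddMonoidHom ℤ).comp
      ((Pi.evalAddMonoidHom (fun _ => ℕ) i).comp (AddMonoidHom.snd ℕ (ι → ℕ)))
  have hL (j v) : L j v = ∑ i, (P i).coeff j * v.2 i := by
    simp [L, AddMonoidHom.finsetSum_apply]
  let mZ : ℕ × (ι → ℕ) →+ ℤ := (Nat.castAddMonoidHom ℤ).comp (AddMonoidHom.fst ℕ (ι → ℕ))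
  have hsum (v : ℕ × (ι → ℕ)) : ∑ i, (P i).eval (v.1 : ℤ) * v.2 i + Q.eval (v.1 : ℤ) =
      ∑ j ∈ Finset.range D, (L j v + Q.coeff j) * (v.1 : ℤ) ^ j := by
    simp only [hL, add_mul, Finset.sum_add_distrib, Finset.sum_mul,
      fun i => eval_eq_sum_range' (hP i), eval_eq_sum_range' hQ]
    rw [Finset.sum_comm]
    congr! 3
    ring
  let C : ℤ := ∑ j ∈ Finset.range D, (∑ i, |(P i).coeff j| + |Q.coeff j|)
  have hC0 : 0 ≤ C := by positivity
  have hC (v) (hv : v ∈ digitBox ι) (j : ℕ) : |L j v + Q.coeff j| ≤ C * v.1 := by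
    by_cases hj : j < D
    · have h1 : ∑ i, |(P i).coeff j| + |Q.coeff j| ≤ C :=
        Finset.single_le_sum (f := fun j => ∑ i, |(P i).coeff j| + |Q.coeff j|)
          (fun _ _ => by positivity) (Finset.mem_range.2 hj)
      calc |L j v + Q.coeff j| ≤ ∑ i, |(P i).coeff j| * v.1 + |Q.coeff j| * v.1 := by
            refine (abs_add_le _ _).trans (add_le_add ?_ ?_)
            · rw [hL]
              refine (Finset.abs_sum_le_sum_abs _ _).trans (Finset.sum_le_sum fun i _ => ?_)
              rw [abs_mul, Nat.abs_cast]
              have := (hv.2 i).le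
              gcongr
            · have : (1 : ℤ) ≤ v.1 := by have := hv.1; omega
              nlinarith [abs_nonneg (Q.coeff j)]
        _ ≤ C * v.1 := by
            rw [← Finset.sum_mul, ← add_mul]
            gcongr
    · have h1 (i) : (P i).coeff j = 0 := coeff_eq_zero_of_natDegree_lt (by have := hP i; omega)
      have h2 : Q.coeff j = 0 := coeff_eq_zero_of_natDegree_lt (by omega)
      simp only [hL, h1, h2]
      simp
      positivity
  have key : {v : ℕ × (ι → ℕ) | v ∈ digitBox ι ∧
      ∑ i, (P i).eval (v.1 : ℤ) * v.2 i + Q.eval (v.1 : ℤ) = 0} =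
      ⋃ c ∈ {c : Fin (D + 1) → ℤ | c ∈ Set.Icc (fun _ => -(2 * C)) (fun _ => 2 * C) ∧
          c 0 = 0 ∧ c (Fin.last D) = 0},
        digitBox ι ∩ ⋂ j : Fin D,
          {v | (c j.castSucc + Q.coeff j) + L j v = 0 + (c j.succ • mZ) v} := by
    ext v
    simp only [Set.mem_ofPred_eq, hsum, Set.mem_iUnion, Set.mem_inter_iff, Set.mem_iInter,
      exists_prop]
    constructor
    · rintro ⟨hv, h⟩
      obtain ⟨c, hc0, hcD, hcb, hc⟩ := exists_carries (m := v.1) (C := C)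
        (by have := hv.1; omega) D _ 0 (by simpa using hC0) (hC v hv) (by simpa using h)
      refine ⟨fun j => c j, ⟨⟨fun j => (abs_le.1 (hcb j)).1, fun j => (abs_le.1 (hcb j)).2⟩,
        hc0, by simpa using hcD⟩, hv, fun j => ?_⟩
      have := hc j j.2
      simp [mZ]
      linarith
    · rintro ⟨c, ⟨-, hc0, hcD⟩, hv, hc⟩
      refine ⟨hv, ?_⟩
      have := sum_range_mul_pow_of_carries (m := v.1) D (fun j => L j v + Q.coeff j)
        (fun j => if h : j < D + 1 then c ⟨j, h⟩ else 0) (fun j hj => by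
          have := hc ⟨j, hj⟩
          simp [mZ, Fin.castSucc_mk, Fin.succ_mk] at this
          simp [hj, Nat.lt_succ_of_lt hj]
          linarith)
      simpa [hc0, show c ⟨D, by omega⟩ = 0 from hcD, show c ⟨0, by omega⟩ = 0 from hc0] using this
  rw [key]
  refine IsSemilinearSet.biUnion ((Set.finite_Icc _ _).subset fun c hc => hc.1) fun c _ =>
    (isSemilinearSet_digitBox ι).inter (.iInter fun j => isSemilinearSet_setOfPred_eq _ _ _ _)

/-- Restriction of the digit vector along `e`, keeping the base. -/
def digitReindex {α β : Type*} (e : α → β) : ℕ × (β → ℕ) →+ ℕ × (α → ℕ) :=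
  (AddMonoidHom.id ℕ).prodMap (LinearMap.funLeft ℕ ℕ e).toAddMonoidHom

@[simp]
theorem digitReindex_apply {α β : Type*} (e : α → β) (v : ℕ × (β → ℕ)) :
    digitReindex e v = (v.1, v.2 ∘ e) := rfl

/-- The number with base `v.1` and digits `v.2`, least significant digit first. -/
def digitVal {D : ℕ} (v : ℕ × (Fin D → ℕ)) : ℕ := ∑ j, v.2 j * v.1 ^ (j : ℕ)

theorem exists_digitVal_eq {m D x : ℕ} (hm : 2 ≤ m) (hx : x < m ^ D) :
    ∃ w : Fin D → ℕ, (m, w) ∈ digitBox (Fin D) ∧ digitVal (m, w) = x := by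
  refine ⟨fun j => finFunctionFinEquiv.symm ⟨x, hx⟩ j, ⟨hm, fun j => Fin.is_lt _⟩, ?_⟩
  have := finFunctionFinEquiv_apply (finFunctionFinEquiv.symm ⟨x, hx⟩)
  rw [Equiv.apply_symm_apply] at this
  exact this.symm

theorem digitVal_lt {D : ℕ} {v : ℕ × (Fin D → ℕ)} (hv : v ∈ digitBox (Fin D)) :
    digitVal v < v.1 ^ D := by
  have h := (finFunctionFinEquiv fun j => (⟨v.2 j, hv.2 j⟩ : Fin v.1)).is_lt
  rwa [finFunctionFinEquiv_apply] at h

theorem digitVal_inj {D m : ℕ} {v w : Fin D → ℕ} (hv : (m, v) ∈ digitBox (Fin D))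
    (hw : (m, w) ∈ digitBox (Fin D)) (h : digitVal (m, v) = digitVal (m, w)) : v = w := by
  have h' : (fun j => (⟨v j, hv.2 j⟩ : Fin m)) = fun j => ⟨w j, hw.2 j⟩ := by
    apply finFunctionFinEquiv.injective
    ext
    simpa only [finFunctionFinEquiv_apply, digitVal] using h
  funext j
  simpa using congrFun h' j

theorem mem_SG_iff {k : ℕ} {f : Fin k → ℕ → ℕ} {n x : ℕ} :
    x ∈ SG k f n ↔ ∃ y : Fin k → ℕ, x = ∑ i, y i * f i n := by
  rw [SG, AddSubmonoid.mem_closure_range_iff]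
  constructor
  · rintro ⟨a, rfl⟩
    exact ⟨a, by simp [Finsupp.sum_fintype]⟩
  · rintro ⟨y, rfl⟩
    exact ⟨Finsupp.equivFunOnFinite.symm y, by simp [Finsupp.sum_fintype]⟩

theorem mem_SG_iff_exists_le {k : ℕ} {f : Fin k → ℕ → ℕ} {n x : ℕ} :
    x ∈ SG k f n ↔ ∃ y : Fin k → ℕ, (∀ i, y i ≤ x) ∧ x = ∑ i, y i * f i n := by
  rw [mem_SG_iff]
  refine ⟨?_, fun ⟨y, _, hy⟩ => ⟨y, hy⟩⟩
  rintro ⟨y, hy⟩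
  refine ⟨fun i => if f i n = 0 then 0 else y i, fun i => ?_, ?_⟩
  · dsimp only
    split_ifs with h
    · exact Nat.zero_le _
    · rw [hy]
      exact (Nat.le_mul_of_pos_right _ (Nat.pos_of_ne_zero h)).trans
        (Finset.single_le_sum (f := fun i => y i * f i n) (fun _ _ => Nat.zero_le _)
          (Finset.mem_univ i))
  · rw [hy]
    refine Finset.sum_congr rfl fun i _ => ?_
    by_cases h : f i n = 0 <;> simp [h]

theorem isSemilinearSet_digitVal_mem_SG {k : ℕ} {f : Fin k → ℕ → ℕ} {p : Fin k → ℤ[X]}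
    (hp : ∀ i, ∀ n : ℕ, (f i n : ℤ) = (p i).eval (n : ℤ)) (D : ℕ) :
    IsSemilinearSet {v | v ∈ digitBox (Fin D) ∧ digitVal v ∈ SG k f v.1} := by
  convert! (isSemilinearSet_polynomial_eq (ι := Fin D ⊕ Fin k × Fin D)
    (Sum.elim (fun j => -X ^ (j : ℕ)) fun ij => p ij.1 * X ^ (ij.2 : ℕ)) 0).image
      (digitReindex Sum.inl) using 1
  ext ⟨m, v⟩
  simp only [Set.mem_ofPred_eq, Set.mem_image, digitReindex_apply, Prod.exists, Prod.mk.injEq,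
    Fintype.sum_sum_type, Sum.elim_inl, Sum.elim_inr, Fintype.sum_prod_type]
  constructor
  · rintro ⟨hv, hS⟩
    obtain ⟨y, hy, hsum⟩ := mem_SG_iff_exists_le.1 hS
    choose w hw hwy using fun i => exists_digitVal_eq (D := D) hv.1
      ((hy i).trans_lt (digitVal_lt hv))
    refine ⟨m, Sum.elim v fun ij => w ij.1 ij.2, ⟨⟨hv.1, ?_⟩, ?_⟩, rfl, rfl⟩
    · rintro (j | ⟨i, j⟩)
      · exact hv.2 j
      · exact (hw i).2 j
    · have h : ((digitVal (m, v) : ℕ) : ℤ) = ∑ i, (y i * f i m : ℤ) := by exact_mod_cast hsum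
      simp only [← hwy, hp, digitVal, Nat.cast_sum, Nat.cast_mul, Nat.cast_pow,
        Finset.sum_mul] at h
      simp only [eval_neg, eval_pow, eval_X, eval_mul, Sum.elim_inl, Sum.elim_inr, eval_zero,
        neg_mul, Finset.sum_neg_distrib, add_zero]
      rw [neg_add_eq_zero]
      convert h using 2 with j _ i
      · ring
      · exact Finset.sum_congr rfl fun j _ => by ring
  · rintro ⟨m, u, ⟨hu, h⟩, rfl, rfl⟩
    refine ⟨⟨hu.1, fun j => hu.2 _⟩, mem_SG_iff.2
      ⟨fun i => digitVal (m, fun j => u (Sum.inr (i, j))), ?_⟩⟩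
    simp only [eval_neg, eval_pow, eval_X, eval_mul, eval_zero,
      neg_mul, Finset.sum_neg_distrib, add_zero] at h
    rw [neg_add_eq_zero] at h
    zify
    simp only [hp, digitVal, Nat.cast_sum, Nat.cast_mul, Nat.cast_pow, Finset.sum_mul,
      Function.comp_apply]
    convert h using 2 with j _ i
    · ring
    · exact Finset.sum_congr rfl fun j _ => by ring

/-- For each base, keeping only the largest number of a semilinear set of digit vectors
preserves semilinearity. -/
theorem isSemilinearSet_digitVal_max {D : ℕ} {V : Set (ℕ × (Fin D → ℕ))}
    (hV : IsSemilinearSet V) (hbox : V ⊆ digitBox (Fin D)) :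
    IsSemilinearSet {v | v ∈ V ∧ ∀ w ∈ V, w.1 = v.1 → digitVal w ≤ digitVal v} := by
  have hB := ((isSemilinearSet_polynomial_eq (ι := (Fin D ⊕ Fin D) ⊕ Fin D)
    (Sum.elim (Sum.elim (fun j => X ^ (j : ℕ)) fun j => -X ^ (j : ℕ)) fun j => X ^ (j : ℕ))
    1).inter (hV.preimage (digitReindex (Sum.inl ∘ Sum.inr)))).image
      (digitReindex (Sum.inl ∘ Sum.inl))
  convert! hV.sdiff hB using 1
  ext ⟨m, v⟩
  simp only [Set.mem_ofPred_eq, Set.mem_sdiff, and_congr_right_iff]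
  intro hv
  rw [iff_not_comm]
  push Not
  simp only [Set.mem_image, Set.mem_inter_iff, Set.mem_ofPred_eq, Set.mem_preimage,
    digitReindex_apply, Prod.exists, Prod.mk.injEq, Fintype.sum_sum_type, Sum.elim_inl,
    Sum.elim_inr, eval_neg, eval_pow, eval_X, eval_one, neg_mul, Finset.sum_neg_distrib]
  constructor
  · rintro ⟨m, u, ⟨⟨hu, h⟩, hw⟩, rfl, rfl⟩
    refine ⟨m, _, hw, rfl, ?_⟩
    zify
    simp only [digitVal, Nat.cast_sum, Nat.cast_mul, Nat.cast_pow, Function.comp_apply]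
    have : 0 ≤ ∑ x : Fin D, (m : ℤ) ^ (x : ℕ) * (u (Sum.inr x) : ℤ) := by positivity
    simp only [mul_comm ((m : ℤ) ^ _)] at h this
    linarith
  · rintro ⟨m, w, hw, rfl, hlt⟩
    obtain ⟨z, hz, hzv⟩ := exists_digitVal_eq (x := digitVal (m, w) - digitVal (m, v) - 1)
      (hbox hw).1 (lt_of_le_of_lt (by omega) (digitVal_lt (hbox hw)))
    refine ⟨_, Sum.elim (Sum.elim v w) z, ⟨⟨⟨hz.1, ?_⟩, ?_⟩, hw⟩, rfl, rfl⟩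
    · rintro ((j | j) | j)
      · exact (hbox hv).2 j
      · exact (hbox hw).2 j
      · exact hz.2 j
    · have h : digitVal (m, v) + digitVal (m, z) + 1 = digitVal (m, w) := by
        rw [hzv]; omega
      zify at h
      simp only [digitVal, Nat.cast_sum, Nat.cast_mul, Nat.cast_pow] at h
      simp only [Sum.elim_inl, Sum.elim_inr, mul_comm ((_ : ℤ) ^ _)]
      linarith

/-- Any gap of a cofinite semigroup is bounded in terms of the generators. -/
theorem lt_of_notMem_SG {k : ℕ} {f : Fin k → ℕ → ℕ} {n x M : ℕ}
    (hfin : ((SG k f n : Set ℕ)ᶜ).Finite) (hx : x ∉ SG k f n) (hM : ∀ i, f i n ≤ M) :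
    x < k * (M * M) := by
  obtain ⟨i₀, hi₀⟩ : ∃ i, f i n ≠ 0 := by
    by_contra! h
    have hpos (j : ℕ) : j + 1 ∈ (SG k f n : Set ℕ)ᶜ := fun hj => by
      obtain ⟨y, hy⟩ := mem_SG_iff.1 hj
      simp [h] at hy
    exact Set.infinite_of_injective_forall_mem (add_left_injective 1) hpos hfin
  set a := f i₀ n
  obtain ⟨t, ht⟩ : ∃ t, x + t * a ∈ SG k f n := by
    by_contra! h
    exact Set.infinite_of_injective_forall_mem (f := fun t : ℕ => x + t * a)
      (fun s t hst => by simpa [hi₀] using hst) h hfin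
  obtain ⟨y, hy⟩ := mem_SG_iff.1 ht
  set s := ∑ i, y i % a * f i n
  have hsS : s ∈ SG k f n := mem_SG_iff.2 ⟨_, rfl⟩
  have hmod : s ≡ x [MOD a] := by
    calc s ≡ ∑ i, y i * f i n [MOD a] :=
          Nat.ModEq.sum fun i _ => (Nat.mod_modEq _ _).mul_right _
      _ ≡ x [MOD a] := by rw [← hy]; simp [Nat.ModEq]
  have hxs : x < s := by
    by_contra! hle
    obtain ⟨c, hc⟩ := (Nat.modEq_iff_dvd' hle).1 hmod
    apply hx
    have haS : a ∈ SG k f n := AddSubmonoid.subset_closure ⟨i₀, rfl⟩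
    have : x = s + c • a := by rw [smul_eq_mul, mul_comm c]; omega
    rw [this]
    exact add_mem hsS (nsmul_mem haS c)
  refine hxs.trans_le ?_
  calc s ≤ ∑ _i : Fin k, M * M := Finset.sum_le_sum fun i _ => Nat.mul_le_mul
        ((Nat.mod_lt _ (Nat.pos_of_ne_zero hi₀)).le.trans (hM i₀)) (hM i)
    _ = _ := by simp

theorem exists_eval_le_pow (p : ℤ[X]) :
    ∃ e N : ℕ, ∀ m : ℕ, N ≤ m → p.eval (m : ℤ) ≤ (m : ℤ) ^ e := by
  induction p using Polynomial.induction_on' with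
  | add p q hp hq =>
    obtain ⟨e₁, N₁, h₁⟩ := hp
    obtain ⟨e₂, N₂, h₂⟩ := hq
    refine ⟨max e₁ e₂ + 1, max 2 (max N₁ N₂), fun m hm => ?_⟩
    have hm1 : (1 : ℤ) ≤ m := by omega
    have hm2 : (2 : ℤ) ≤ m := by omega
    have h1 := (h₁ m (by omega)).trans (pow_le_pow_right₀ hm1 (le_max_left e₁ e₂))
    have h2 := (h₂ m (by omega)).trans (pow_le_pow_right₀ hm1 (le_max_right e₁ e₂))
    rw [eval_add, pow_succ]
    nlinarith [pow_pos (by omega : (0 : ℤ) < m) (max e₁ e₂)]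
  | monomial j a =>
    refine ⟨j + 1, a.natAbs, fun m hm => ?_⟩
    rw [eval_monomial, pow_succ, mul_comm]
    gcongr
    omega

/-- The generators of `S_n` are eventually bounded by powers of `n`, hence so are the gaps of
`S_n` whenever there are finitely many. -/
theorem exists_gap_bound {k : ℕ} {f : Fin k → ℕ → ℕ} {p : Fin k → ℤ[X]}
    (hp : ∀ i, ∀ n : ℕ, (f i n : ℤ) = (p i).eval (n : ℤ)) :
    ∃ D N : ℕ, 2 ≤ N ∧ ∀ n, N ≤ n → ((SG k f n : Set ℕ)ᶜ).Finite →
      ∀ x ∉ SG k f n, x < n ^ D := by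
  choose e N h using fun i => exists_eval_le_pow (p i)
  refine ⟨1 + (∑ i, e i + ∑ i, e i), 2 + k + ∑ i, N i, by omega, fun n hn hfin x hx => ?_⟩
  have hM (i) : f i n ≤ n ^ ∑ i, e i := by
    have hN := Finset.single_le_sum (fun i _ => Nat.zero_le (N i)) (Finset.mem_univ i)
    have he := Finset.single_le_sum (fun i _ => Nat.zero_le (e i)) (Finset.mem_univ i)
    have h' := h i n (by omega)
    rw [← hp] at h'
    exact le_trans (by exact_mod_cast h') (Nat.pow_le_pow_right (by omega) he)
  refine (lt_of_notMem_SG hfin hx hM).trans_le ?_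
  rw [pow_add, pow_add, pow_one]
  gcongr
  omega

theorem apply_add_mul_eq_of_eventually_periodic {α : Type*} {c : ℕ → α} {N p : ℕ}
    (h : ∀ n, N ≤ n → c (n + p) = c n) (k : ℕ) {n : ℕ} (hn : N ≤ n) : c (n + k * p) = c n := by
  induction k with
  | zero => simp
  | succ k ih => rw [add_mul, one_mul, ← add_assoc, h _ (by omega), ih]

open Classical in
theorem EvPeriodic.ite {s : Set ℕ} (hs : IsSemilinearSet s) {c d : ℕ → ℚ} (hc : EvPeriodic c)
    (hd : EvPeriodic d) : EvPeriodic fun n => if n ∈ s then c n else d n := by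
  obtain ⟨N₁, p₁, hp₁, h₁⟩ := Nat.isSemilinearSet_iff_ultimately_periodic.1 hs
  obtain ⟨N₂, p₂, hp₂, h₂⟩ := hc
  obtain ⟨N₃, p₃, hp₃, h₃⟩ := hd
  refine ⟨max N₁ (max N₂ N₃), p₁ * p₂ * p₃, Nat.mul_pos (Nat.mul_pos hp₁ hp₂) hp₃,
    fun n hn => ?_⟩
  have e₁ : (n + p₁ * p₂ * p₃ ∈ s) = (n ∈ s) := by
    rw [show p₁ * p₂ * p₃ = p₂ * p₃ * p₁ by ring]
    exact apply_add_mul_eq_of_eventually_periodic (c := fun n => n ∈ s) (fun n hn => propext (h₁ n hn).symm) _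
      (by omega : N₁ ≤ n)
  have e₂ : c (n + p₁ * p₂ * p₃) = c n := by
    rw [show p₁ * p₂ * p₃ = p₁ * p₃ * p₂ by ring]
    exact apply_add_mul_eq_of_eventually_periodic h₂ _ (by omega)
  have e₃ : d (n + p₁ * p₂ * p₃) = d n := apply_add_mul_eq_of_eventually_periodic h₃ _ (by omega)
  simp only [e₁, e₂, e₃]

theorem EvPeriodic.const (a : ℚ) : EvPeriodic fun _ => a := ⟨0, 1, le_rfl, fun _ _ => rfl⟩

open Classical in
theorem IsEQP.ite {s : Set ℕ} (hs : IsSemilinearSet s) {g h : ℕ → ℤ} (hg : IsEQP g) (q : ℚ[X])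
    (hq : ∀ n ∈ s, (h n : ℚ) = q.eval (n : ℚ)) : IsEQP fun n => if n ∈ s then h n else g n := by
  obtain ⟨d, c, hc, hgc⟩ := hg
  refine ⟨max d q.natDegree,
    fun i n => if n ∈ s then q.coeff i else if i ≤ d then c i n else 0, fun i _ => ?_,
    fun n => ?_⟩
  · refine EvPeriodic.ite hs (.const _) ?_
    by_cases hi : i ≤ d
    · simpa only [if_pos hi] using hc i hi
    · simpa only [if_neg hi] using EvPeriodic.const 0
  · by_cases hn : n ∈ s
    · simp only [if_pos hn]
      exact (hq n hn).trans (eval_eq_sum_range' (by omega) _)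
    · simp only [if_neg hn]
      rw [hgc]
      refine Finset.sum_subset_zero_on_sdiff (Finset.range_mono (by omega)) (fun i hi => ?_)
        fun i hi => ?_
      · simp only [Finset.mem_sdiff, Finset.mem_range] at hi
        rw [if_neg (by omega), zero_mul]
      · rw [if_pos (by simpa [Nat.lt_succ_iff] using hi)]

theorem IsEQP.zero : IsEQP 0 := ⟨0, fun _ _ => 0, fun _ _ => .const 0, by simp⟩

theorem IsEQP.of_eventually_eq {g h : ℕ → ℤ} (hg : IsEQP g) (N : ℕ)
    (hgh : ∀ n, N ≤ n → h n = g n) : IsEQP h := by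
  obtain ⟨d, c, hc, hgc⟩ := hg
  refine ⟨d, fun i n => if n < N then (if i = 0 then (h n : ℚ) else 0) else c i n,
    fun i hi => ?_, fun n => ?_⟩
  · obtain ⟨M, p, hp, hM⟩ := hc i hi
    refine ⟨max M N, p, hp, fun n hn => ?_⟩
    simp only [if_neg (by omega : ¬ n < N), if_neg (by omega : ¬ n + p < N)]
    exact hM n (by omega)
  · by_cases hn : n < N
    · simp [if_pos hn]
    · simp only [if_neg hn]
      rw [hgh n (by omega), hgc]

/-- A linear set that is the graph of a partial function of the first coordinate is the graph
of an affine function. -/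
theorem IsLinearSet.exists_affine {κ : Type*} {L : Set (ℕ × (κ → ℕ))} (hL : IsLinearSet L)
    (hinj : Set.InjOn Prod.fst L) :
    ∃ α β : κ → ℚ, ∀ v ∈ L, ∀ j, (v.2 j : ℚ) = α j + β j * v.1 := by
  obtain ⟨a, P, -, rfl⟩ := isLinearSet_iff_exists_fg_eq_vadd.1 hL
  have hP {q r : ℕ × (κ → ℕ)} (hq : q ∈ P) (hr : r ∈ P) (h : q.1 = r.1) : q = r := by
    have := hinj (Set.vadd_mem_vadd_set (a := a) hq) (Set.vadd_mem_vadd_set (a := a) hr)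
      (by simp [h])
    simpa using this
  obtain ⟨β, hβ⟩ : ∃ β : κ → ℚ, ∀ q ∈ P, ∀ j, (q.2 j : ℚ) = β j * q.1 := by
    by_cases h : ∃ p ∈ P, p.1 ≠ 0
    · obtain ⟨p, hp, hp0⟩ := h
      refine ⟨fun j => p.2 j / p.1, fun q hq j => ?_⟩
      have := congrFun (congrArg Prod.snd (hP (nsmul_mem hq p.1) (nsmul_mem hp q.1)
        (by simp [mul_comm]))) j
      simp only [Prod.smul_snd, Pi.smul_apply, smul_eq_mul] at this
      have hp0' : (p.1 : ℚ) ≠ 0 := by exact_mod_cast hp0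
      field_simp
      exact_mod_cast (by linarith : q.2 j * p.1 = p.2 j * q.1)
    · push Not at h
      refine ⟨0, fun q hq j => ?_⟩
      rw [hP hq (zero_mem P) (h q hq)]
      simp
  refine ⟨fun j => a.2 j - β j * a.1, β, ?_⟩
  rintro _ ⟨q, hq, rfl⟩ j
  have := hβ q hq j
  simp only [vadd_eq_add, Prod.snd_add, Prod.fst_add, Pi.add_apply, Nat.cast_add, this]
  ring

/-- A semilinear set of digit vectors with at most one member for each base gives an eventually
quasi-polynomial function of the base. -/
theorem IsSemilinearSet.exists_isEQP_digitVal {D : ℕ} {F : Set (ℕ × (Fin D → ℕ))}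
    (hF : IsSemilinearSet F) (hinj : Set.InjOn Prod.fst F) :
    ∃ g, IsEQP g ∧ ∀ v ∈ F, g v.1 = digitVal v := by
  classical
  obtain ⟨S, hS, hlin, rfl⟩ := hF
  induction S, hS using Set.Finite.induction_on with
  | empty => exact ⟨0, .zero, by simp⟩
  | @insert L S _ _ ih =>
    simp only [Set.sUnion_insert] at hinj
    have hL := hlin L (Set.mem_insert _ _)
    obtain ⟨g, hg, hgS⟩ := ih (fun t ht => hlin t (Set.mem_insert_of_mem _ ht))
      (hinj.mono Set.subset_union_right)
    obtain ⟨α, β, hαβ⟩ := hL.exists_affine (hinj.mono Set.subset_union_left)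
    have hex (n : ℕ) : ∃ x : ℤ, ∀ v ∈ L, v.1 = n → x = digitVal v := by
      by_cases h : ∃ v ∈ L, v.1 = n
      · obtain ⟨v, hv, rfl⟩ := h
        exact ⟨digitVal v, fun w hw h => by
          rw [hinj (Or.inl hw) (Or.inl hv) h]⟩
      · push Not at h
        exact ⟨0, fun v hv hvn => absurd hvn (h v hv)⟩
    choose h hh using hex
    refine ⟨_, hg.ite (hL.isSemilinearSet.image (AddMonoidHom.fst ℕ (Fin D → ℕ)))
      (h := h) (∑ j : Fin D, (C (α j) + C (β j) * X) * X ^ (j : ℕ)) ?_, ?_⟩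
    · rintro _ ⟨v, hv, rfl⟩
      simp only [AddMonoidHom.coe_fst, hh _ v hv rfl, digitVal, eval_finsetSum]
      push_cast
      exact Finset.sum_congr rfl fun j _ => by simp [hαβ v hv j]
    · intro v hv
      simp only [Set.sUnion_insert] at hv
      split_ifs with hmem
      · obtain ⟨w, hw, hwv⟩ := hmem
        rw [← hinj (Or.inl hw) hv hwv]
        exact hh _ w hw rfl
      · rcases hv with hv | hv
        · exact absurd ⟨v, hv, rfl⟩ hmem
        · exact hgS v hv

theorem stmt3 (k : ℕ) (hk : 1 ≤ k) (f : Fin k → ℕ → ℕ)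
    (hf : ∀ i, ∃ p : Polynomial ℤ, ∀ n : ℕ, (f i n : ℤ) = p.eval (n : ℤ)) :
    ∃ g : ℕ → ℤ, IsEQP g ∧
      ∀ n : ℕ, ((SG k f n : Set ℕ)ᶜ).Finite → ((SG k f n : Set ℕ)ᶜ).Nonempty →
        g n = ((sSup ((SG k f n : Set ℕ)ᶜ) : ℕ) : ℤ) := by
  choose p hp using hf
  obtain ⟨D, N, hN, hgap⟩ := exists_gap_bound hp
  have hV := (isSemilinearSet_digitBox (Fin D)).sdiff (isSemilinearSet_digitVal_mem_SG hp D)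
  obtain ⟨g, hg, hgF⟩ :=
      (isSemilinearSet_digitVal_max hV Set.sdiff_subset).exists_isEQP_digitVal (by
    rintro ⟨m, v⟩ ⟨hv, hvmax⟩ ⟨_, w⟩ ⟨hw, hwmax⟩ rfl
    rw [digitVal_inj hv.1 hw.1 (le_antisymm (hwmax _ hv rfl) (hvmax _ hw rfl))])
  refine ⟨fun n => if n < N then ((sSup ((SG k f n : Set ℕ)ᶜ) : ℕ) : ℤ) else g n,
    hg.of_eventually_eq N fun n hn => if_neg (by omega), fun n hfin hne => ?_⟩
  dsimp only
  split_ifs with hn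
  · rfl
  · have hmem := Nat.sSup_mem hne hfin.bddAbove
    obtain ⟨v, hv, hval⟩ := exists_digitVal_eq (D := D) (by omega : 2 ≤ n)
      (hgap n (by omega) hfin _ hmem)
    rw [← hval]
    refine hgF (n, v) ⟨⟨hv, fun h => hmem (hval ▸ h.2)⟩, ?_⟩
    rintro ⟨_, w⟩ ⟨hw, hwS⟩ rfl
    rw [hval]
    exact le_csSup hfin.bddAbove fun h => hwS ⟨hw, h⟩
end

section
/- Let f_1, …, f_k : ℕ → ℕ be functions given by polynomials with integer coefficients, and for each n let S_n ⊆ ℕ be the additive submonoid generated by f_1(n), …, f_k(n). Then the set of all n ∈ ℕ for which S_n is a symmetric numerical semigroup (i.e., ℕ \ S_n is finite and nonempty with maximum F, and for every z ∈ ℤ with z ∉ S_n one has F − z ∈ S_n) is eventually periodic. -/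
/-- A set `A ⊆ ℕ` is eventually periodic if there are `N` and `p ≥ 1` such that
for all `n ≥ N`, `n ∈ A ↔ n + p ∈ A`. -/
def EvPeriodicSet (A : Set ℕ) : Prop :=
  ∃ N p : ℕ, 1 ≤ p ∧ ∀ n, N ≤ n → (n ∈ A ↔ n + p ∈ A)

/-- The image of `SG k f n` in `ℤ`. -/
def SGZ (k : ℕ) (f : Fin k → ℕ → ℕ) (n : ℕ) : Set ℤ :=
  (fun m : ℕ => (m : ℤ)) '' (SG k f n : Set ℕ)


open FirstOrder.Language Polynomial

/-! ### Presburger definability of sets cut out by linear equations -/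

section Presburger

variable {α : Type*}

theorem definable_linear_eq_zero [Fintype α] (c : α → ℤ) (b : ℤ) :
    (∅ : Set ℕ).Definable presburger {v : α → ℕ | ∑ a, c a * (v a : ℤ) + b = 0} := by
  rw [presburger.definable_iff_isSemilinearSet]
  convert! Nat.isSemilinearSet_setOfPred_mulVec_eq (fun _ : Unit => b.toNat)
    (fun _ : Unit => (-b).toNat) (.of fun _ a => (c a).toNat) (.of fun _ a => (-c a).toNat)
    using 1
  ext v
  simp only [Set.mem_ofPred_eq, funext_iff, Pi.add_apply, Matrix.mulVec, dotProduct,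
    Matrix.of_apply, forall_const]
  zify
  have hc (a : α) : c a = ((c a).toNat : ℤ) - ((-c a).toNat : ℤ) := by lia
  have hsum : ∑ a, c a * (v a : ℤ) =
      ∑ a, ((c a).toNat : ℤ) * v a - ∑ a, ((-c a).toNat : ℤ) * v a := by
    rw [← Finset.sum_sub_distrib]
    exact Finset.sum_congr rfl fun a _ => by rw [← sub_mul, ← hc]
  lia

theorem definable_lt [Fintype α] (a b : α) :
    (∅ : Set ℕ).Definable presburger {v : α → ℕ | v a < v b} := by
  classical
  convert! (definable_linear_eq_zero (α := α ⊕ Unit)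
    (Sum.elim (Pi.single a 1 - Pi.single b 1) 1) 1).exists_of_finite using 1
  ext v
  simp only [Set.mem_ofPred_eq, Fintype.sum_sum_type, Sum.elim_inl, Sum.elim_inr, Pi.sub_apply,
    sub_mul, Finset.sum_sub_distrib, Pi.single_apply, ite_mul, one_mul, zero_mul,
    Finset.sum_ite_eq', Finset.mem_univ, if_true, Pi.one_apply, Fintype.sum_unique]
  constructor
  · intro h
    exact ⟨fun _ => v b - v a - 1, by lia⟩
  · rintro ⟨w, hw⟩
    lia

/-- The tuples of digits `v (some i)` with respect to the base `v none`. -/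
def digitTuples (β : Type*) : Set (Option β → ℕ) :=
  {v | 0 < v none ∧ ∀ i, v (some i) < v none}

theorem definable_digitTuples {β : Type*} [Fintype β] :
    (∅ : Set ℕ).Definable presburger (digitTuples β) := by
  have hpos : (∅ : Set ℕ).Definable presburger {v : Option β → ℕ | 0 < v none} := by
    classical
    convert! (definable_linear_eq_zero (α := Option β) (Pi.single none 1) 0).compl using 1
    ext v
    simp [Pi.single_apply, Nat.pos_iff_ne_zero]
  have hlt : (∅ : Set ℕ).Definable presburger
      (⋂ i : β, {v : Option β → ℕ | v (some i) < v none}) :=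
    Set.definable_iInter_of_finite fun i => definable_lt (some i) none
  convert! hpos.inter hlt using 1
  ext v
  simp [digitTuples]

/-- If `v` is a tuple of digits to the base `v none`, the lowest coefficient of
`∑ i, v (some i) * P i + Q` is a bounded multiple of the base whenever the value at the base is
zero, so a polynomial equation can be checked coefficient by coefficient with bounded carries. -/
theorem definable_digitTuples_inter_eval_eq_zero {β : Type*} [Fintype β] (d : ℕ)
    (P : β → ℤ[X]) (Q : ℤ[X]) (hP : ∀ i, (P i).natDegree ≤ d) (hQ : Q.natDegree ≤ d) :
    (∅ : Set ℕ).Definable presburger (digitTuples β ∩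
      {v | ∑ i, (v (some i) : ℤ) * (P i).eval (v none : ℤ) + Q.eval (v none : ℤ) = 0}) := by
  induction d generalizing P Q with
  | zero =>
    refine definable_digitTuples.inter ?_
    convert! definable_linear_eq_zero (α := Option β)
      (fun o => o.elim 0 fun i => (P i).coeff 0) (Q.coeff 0) using 1
    ext v
    have hPv (i : β) : (P i).eval (v none : ℤ) = (P i).coeff 0 := by
      rw [eq_C_of_natDegree_le_zero (hP i)]; simp
    have hQv : Q.eval (v none : ℤ) = Q.coeff 0 := by
      rw [eq_C_of_natDegree_le_zero hQ]; simp
    simp [hPv, hQv, Fintype.sum_option, mul_comm]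
  | succ d ih =>
    set B : ℤ := ∑ i, |(P i).coeff 0| + |Q.coeff 0| with hB
    have hcarry (q : ℤ) : (∅ : Set ℕ).Definable presburger
        ({v : Option β → ℕ | ∑ o, (o.elim (-q) fun i => (P i).coeff 0) * (v o : ℤ)
            + Q.coeff 0 = 0} ∩
          (digitTuples β ∩ {v | ∑ i, (v (some i) : ℤ) * (P i).divX.eval (v none : ℤ) +
            (Q.divX + C q).eval (v none : ℤ) = 0})) := by
      refine (definable_linear_eq_zero _ _).inter (ih _ _ (fun i => ?_) ?_)
      · rw [natDegree_divX_eq_natDegree_tsub_one]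
        have := hP i
        lia
      · refine (natDegree_add_le _ _).trans (max_le ?_ (by simp))
        rw [natDegree_divX_eq_natDegree_tsub_one]
        lia
    convert! Set.definable_biUnion_finset hcarry (Finset.Icc (-B) B) using 1
    ext v
    have heval (p : ℤ[X]) (x : ℤ) : p.eval x = p.divX.eval x * x + p.coeff 0 := by
      conv_lhs => rw [← divX_mul_X_add p]
      simp
    have hsplit : ∑ i, (v (some i) : ℤ) * (P i).eval (v none : ℤ) + Q.eval (v none : ℤ) =
        (∑ i, (v (some i) : ℤ) * (P i).divX.eval (v none : ℤ) + Q.divX.eval (v none : ℤ)) *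
          v none + (∑ i, (v (some i) : ℤ) * (P i).coeff 0 + Q.coeff 0) := by
      simp_rw [heval (P _) (v none), heval Q (v none), mul_add, Finset.sum_add_distrib, add_mul,
        Finset.sum_mul, mul_assoc]
      ring
    have hcomm : ∑ i, (P i).coeff 0 * (v (some i) : ℤ) = ∑ i, (v (some i) : ℤ) * (P i).coeff 0 :=
      Finset.sum_congr rfl fun i _ => mul_comm _ _
    simp only [Set.mem_inter_iff, Set.mem_iUnion, Set.mem_ofPred_eq, Fintype.sum_option,
      Option.elim_none, Option.elim_some, eval_add, eval_C, exists_prop, Finset.mem_Icc, hsplit,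
      hcomm]
    set s := ∑ i, (v (some i) : ℤ) * (P i).divX.eval (v none : ℤ) + Q.divX.eval (v none : ℤ)
      with hs
    set r := ∑ i, (v (some i) : ℤ) * (P i).coeff 0 with hr
    constructor
    · rintro ⟨hv, h⟩
      refine ⟨-s, ?_, by linarith, hv, by rw [hs]; ring⟩
      have hpos : (0 : ℤ) < v none := by exact_mod_cast hv.1
      have hbound : |r + Q.coeff 0| ≤ B * v none := by
        rw [hB, add_mul, Finset.sum_mul, hr]
        refine (abs_add_le _ _).trans (add_le_add ?_ ?_)
        · refine (Finset.abs_sum_le_sum_abs _ _).trans (Finset.sum_le_sum fun i _ => ?_)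
          rw [abs_mul, mul_comm, Nat.abs_cast]
          gcongr
          exact (hv.2 i).le
        · exact le_mul_of_one_le_right (abs_nonneg _) (by lia)
      rw [abs_le] at hbound
      constructor
      · have : -B * v none ≤ -s * v none := by linarith
        exact le_of_mul_le_mul_right this hpos
      · have : -s * v none ≤ B * v none := by linarith
        exact le_of_mul_le_mul_right this hpos
    · rintro ⟨q, -, hlow, hv, hhigh⟩
      refine ⟨hv, ?_⟩
      have : s = -q := by rw [hs]; linarith
      rw [this]
      linarith

end Presburger

/-! ### Relations that become Presburger definable after expansion in base `n` -/

/-- The natural numbers `x i < n ^ D` with the given base-`n` digits. -/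
def digitValues {ι : Type*} {D : ℕ} (v : Option (ι × Fin D) → ℕ) (i : ι) : ℕ :=
  ∑ j : Fin D, v (some (i, j)) * v none ^ (j : ℕ)

/-- A relation between `n` and a tuple of natural numbers is digit definable if, on tuples of
numbers below `n ^ D`, it is Presburger definable in terms of `n` and the base-`n` digits. -/
def DigitDefinable (D : ℕ) {ι : Type*} (R : ℕ → (ι → ℕ) → Prop) : Prop :=
  (∅ : Set ℕ).Definable presburger
    (digitTuples (ι × Fin D) ∩ {v | R (v none) (digitValues v)})

theorem sum_digits_lt {D n : ℕ} {d : Fin D → ℕ} (hd : ∀ j, d j < n) :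
    ∑ j, d j * n ^ (j : ℕ) < n ^ D :=
  (finFunctionFinEquiv fun j => (⟨d j, hd j⟩ : Fin n)).isLt

theorem exists_digits {D n y : ℕ} (hy : y < n ^ D) :
    ∃ d : Fin D → ℕ, (∀ j, d j < n) ∧ ∑ j, d j * n ^ (j : ℕ) = y := by
  refine ⟨fun j => finFunctionFinEquiv.symm ⟨y, hy⟩ j, fun j => Fin.isLt _, ?_⟩
  rw [← finFunctionFinEquiv_apply, Equiv.apply_symm_apply]

namespace DigitDefinable

variable {D : ℕ} {ι κ : Type*} {R R' : ℕ → (ι → ℕ) → Prop}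

theorem congr (hR : DigitDefinable D R)
    (h : ∀ n x, (∀ i, x i < n ^ D) → (R n x ↔ R' n x)) : DigitDefinable D R' := by
  unfold DigitDefinable at *
  convert! hR using 1
  ext v
  exact and_congr_right fun hv => (h _ _ fun i => sum_digits_lt fun j => hv.2 (i, j)).symm

theorem and (hR : DigitDefinable D R) (hR' : DigitDefinable D R') :
    DigitDefinable D fun n x => R n x ∧ R' n x := by
  unfold DigitDefinable at *
  convert! hR.inter hR' using 1
  ext v
  simp only [Set.mem_inter_iff, Set.mem_ofPred_eq]
  tauto

theorem not [Fintype ι] (hR : DigitDefinable D R) : DigitDefinable D fun n x => ¬ R n x := by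
  unfold DigitDefinable at *
  convert! definable_digitTuples.sdiff hR using 1
  ext v
  simp only [Set.mem_inter_iff, Set.mem_ofPred_eq, Set.mem_sdiff]
  tauto

theorem imp [Fintype ι] (hR : DigitDefinable D R) (hR' : DigitDefinable D R') :
    DigitDefinable D fun n x => R n x → R' n x :=
  (hR.and hR'.not).not.congr fun _ _ _ => by tauto

theorem or [Fintype ι] (hR : DigitDefinable D R) (hR' : DigitDefinable D R') :
    DigitDefinable D fun n x => R n x ∨ R' n x :=
  (hR.not.imp hR').congr fun _ _ _ => by tauto

theorem exists_lt [Finite κ] {R : ℕ → (ι ⊕ κ → ℕ) → Prop}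
    (hR : DigitDefinable D R) :
    DigitDefinable D fun n x => ∃ y : κ → ℕ, (∀ i, y i < n ^ D) ∧ R n (Sum.elim x y) := by
  unfold DigitDefinable at *
  let e : Option ((ι ⊕ κ) × Fin D) → Option (ι × Fin D) ⊕ (κ × Fin D) :=
    fun o => o.elim (Sum.inl none) fun p =>
      Sum.elim (fun i => Sum.inl (some (i, p.2))) (fun i => Sum.inr (i, p.2)) p.1
  have hval (v : Option (ι × Fin D) → ℕ) (u : κ × Fin D → ℕ) :
      digitValues (Sum.elim v u ∘ e) = Sum.elim (digitValues v)
        fun i => ∑ j, u (i, j) * v none ^ (j : ℕ) := by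
    ext (i | i) <;> simp [digitValues, e]
  convert! (hR.preimage_comp e).exists_of_finite using 1
  ext v
  simp only [Set.mem_inter_iff, Set.mem_ofPred_eq, Set.mem_preimage, hval]
  constructor
  · rintro ⟨hv, y, hy, hRy⟩
    choose d hd hdy using fun i => exists_digits (hy i)
    refine ⟨fun p => d p.1 p.2, ⟨by simpa [e] using hv.1, ?_⟩, ?_⟩
    · rintro ⟨i | i, j⟩
      · simpa [e] using hv.2 (i, j)
      · simpa [e] using hd i j
    · simpa [e, hdy] using hRy
  · rintro ⟨u, ⟨hpos, hlt⟩, hRu⟩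
    have hn : (Sum.elim v u ∘ e) none = v none := rfl
    rw [hn] at hpos hlt hRu
    exact ⟨⟨hpos, fun p => hlt (Sum.inl p.1, p.2)⟩, _,
      fun i => sum_digits_lt fun j => hlt (Sum.inr i, j), hRu⟩

theorem forall_lt [Fintype ι] [Fintype κ] {R : ℕ → (ι ⊕ κ → ℕ) → Prop}
    (hR : DigitDefinable D R) :
    DigitDefinable D fun n x => ∀ y : κ → ℕ, (∀ i, y i < n ^ D) → R n (Sum.elim x y) :=
  hR.not.exists_lt.not.congr fun n x _ => by push Not; rfl

theorem linear_eq_zero [Fintype ι] (p : ι → ℤ[X]) (q : ℤ[X]) :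
    DigitDefinable D fun n x =>
      ∑ i, (p i).eval (n : ℤ) * (x i : ℤ) + q.eval (n : ℤ) = 0 := by
  let P : ι × Fin D → ℤ[X] := fun a => p a.1 * X ^ (a.2 : ℕ)
  let d := Finset.univ.sup (fun a => (P a).natDegree) ⊔ q.natDegree
  have hd := definable_digitTuples_inter_eval_eq_zero d P q
    (fun a => (Finset.le_sup (f := fun a => (P a).natDegree) (Finset.mem_univ a)).trans
      le_sup_left) le_sup_right
  unfold DigitDefinable
  convert! hd using 6 with v
  simp only [P, digitValues, eval_mul, eval_pow, eval_X, Fintype.sum_prod_type, Nat.cast_sum,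
    Nat.cast_mul, Nat.cast_pow, Finset.mul_sum]
  refine Finset.sum_congr rfl fun i _ => Finset.sum_congr rfl fun j _ => ?_
  ring

theorem evPeriodicSet {R : ℕ → (Empty → ℕ) → Prop} (hR : DigitDefinable D R) :
    EvPeriodicSet {n | 0 < n ∧ R n Empty.elim} := by
  have hdef : (∅ : Set ℕ).Definable₁ presburger {n | 0 < n ∧ R n Empty.elim} := by
    unfold Set.Definable₁
    unfold DigitDefinable at hR
    convert! hR.preimage_comp (β := Fin 1) (fun _ => 0) using 1
    ext v
    simp only [Set.mem_ofPred_eq, Set.mem_preimage, Set.mem_inter_iff, digitTuples,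
      Function.comp_apply, IsEmpty.forall_iff, and_true]
    rw [Subsingleton.elim (digitValues _) Empty.elim]
  obtain ⟨N, p, hp, h⟩ := presburger.definable₁_iff_ultimately_periodic.1 hdef
  exact ⟨N, p, hp, h⟩

end DigitDefinable

/-! ### Bounds for submonoids of the natural numbers -/

section Generators

variable {κ : Type*} [Fintype κ] {g : κ → ℕ}

theorem mem_closure_range_iff_exists_sum_mul {x : ℕ} :
    x ∈ AddSubmonoid.closure (Set.range g) ↔ ∃ a : κ → ℕ, ∑ i, a i * g i = x := by
  simp [AddSubmonoid.mem_closure_range_iff_of_fintype, eq_comm]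

theorem mem_closure_range_iff_exists_lt {x B : ℕ} (hx : x < B) :
    x ∈ AddSubmonoid.closure (Set.range g) ↔
      ∃ a : κ → ℕ, (∀ i, a i < B) ∧ ∑ i, a i * g i = x := by
  rw [mem_closure_range_iff_exists_sum_mul]
  refine ⟨?_, fun ⟨a, _, ha⟩ => ⟨a, ha⟩⟩
  rintro ⟨a, rfl⟩
  refine ⟨fun i => if g i = 0 then 0 else a i, fun i => ?_,
    Finset.sum_congr rfl fun i _ => by by_cases h : g i = 0 <;> simp [h]⟩
  dsimp only
  split_ifs with h
  · lia
  · have hle : a i * g i ≤ ∑ i, a i * g i :=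
      Finset.single_le_sum (f := fun i => a i * g i) (fun _ _ => Nat.zero_le _) (Finset.mem_univ i)
    have : a i ≤ a i * g i := Nat.le_mul_of_pos_right _ (Nat.pos_of_ne_zero h)
    lia

theorem exists_generator_pos {x : ℕ} (hx : x ∈ AddSubmonoid.closure (Set.range g))
    (hpos : 0 < x) : ∃ i, 0 < g i := by
  obtain ⟨a, rfl⟩ := mem_closure_range_iff_exists_sum_mul.1 hx
  by_contra! h
  have (i : κ) : g i = 0 := Nat.le_zero.1 (h i)
  simp [this] at hpos

theorem lt_sq_sum_of_notMem_closure_range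
    (hfin : ((AddSubmonoid.closure (Set.range g) : Set ℕ)ᶜ).Finite) {x : ℕ}
    (hx : x ∉ AddSubmonoid.closure (Set.range g)) : x < (∑ i, g i) ^ 2 := by
  obtain ⟨N, hN⟩ := hfin.bddAbove
  have hmem (y : ℕ) (hy : N < y) : y ∈ AddSubmonoid.closure (Set.range g) := by
    by_contra h
    exact hy.not_ge (hN h)
  obtain ⟨i₀, hi₀⟩ := exists_generator_pos (hmem (N + 1) N.lt_succ_self) N.succ_pos
  set m := g i₀ with hm
  have hmG : m ≤ ∑ i, g i :=
    Finset.single_le_sum (fun _ _ => Nat.zero_le _) (Finset.mem_univ i₀)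
  have hlarge : N < x + m * (N + 1) := by nlinarith
  obtain ⟨a, ha⟩ := mem_closure_range_iff_exists_sum_mul.1 (hmem _ hlarge)
  set s := ∑ i, (a i % m) * g i with hs
  have hsmem : s ∈ AddSubmonoid.closure (Set.range g) :=
    mem_closure_range_iff_exists_sum_mul.2 ⟨_, rfl⟩
  have hle : s ≤ m * ∑ i, g i := by
    rw [Finset.mul_sum]
    exact Finset.sum_le_sum fun i _ => Nat.mul_le_mul_right _ (Nat.mod_lt _ hi₀).le
  have hmod : s ≡ x [MOD m] := by
    have h : s ≡ ∑ i, a i * g i [MOD m] :=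
      Nat.ModEq.sum fun i _ => (Nat.mod_modEq _ _).mul_right _
    rw [ha] at h
    exact h.trans (by simp [Nat.ModEq])
  by_contra! hxge
  have hsx : s ≤ x := by nlinarith
  obtain ⟨c, hc⟩ := (Nat.modEq_iff_dvd' hsx).1 hmod
  refine hx ?_
  rw [show x = s + c • m by rw [smul_eq_mul, mul_comm]; lia]
  exact add_mem hsmem (nsmul_mem (AddSubmonoid.subset_closure (Set.mem_range_self i₀)) c)

/-- If `T` bounds the square of the sum of the generators, then being a symmetric numerical
semigroup is witnessed by numbers below any `B > 2 * T`. -/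
theorem symmetric_iff_exists_lt {T B : ℕ} (hT : (∑ i, g i) ^ 2 ≤ T) (hB : 2 * T < B)
    {S : AddSubmonoid ℕ} (hS : S = AddSubmonoid.closure (Set.range g)) :
    (((S : Set ℕ)ᶜ).Finite ∧ ((S : Set ℕ)ᶜ).Nonempty ∧
      ∀ z : ℤ, z ∉ (fun m : ℕ => (m : ℤ)) '' (S : Set ℕ) →
        ((sSup ((S : Set ℕ)ᶜ) : ℕ) : ℤ) - z ∈ (fun m : ℕ => (m : ℤ)) '' (S : Set ℕ)) ↔
    ∃ F < B, F ∉ S ∧ F < T ∧ (∀ w < B, ∀ z < B, F + w + 1 = z → z ∈ S) ∧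
      ∀ w < B, ∀ z < B, w + z = F → w ∈ S ∨ z ∈ S := by
  constructor
  · rintro ⟨hfin, hne, hsymm⟩
    set F := sSup ((S : Set ℕ)ᶜ) with hF
    have hFmem : F ∉ S := Nat.sSup_mem hne hfin.bddAbove
    have hFT : F < T := by
      subst hS
      exact (lt_sq_sum_of_notMem_closure_range hfin hFmem).trans_le hT
    refine ⟨F, by lia, hFmem, hFT, ?_, ?_⟩
    · rintro w - z - hz
      by_contra hzS
      have : z ≤ F := le_csSup hfin.bddAbove hzS
      lia
    · rintro w - z - hwz
      rw [or_iff_not_imp_left]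
      intro hw
      obtain ⟨y, hy, hyz⟩ := hsymm w (by simpa using hw)
      obtain rfl : y = z := by
        dsimp only at hyz
        lia
      exact hy
  · rintro ⟨F, hFB, hFS, hFT, habove, hsymm⟩
    obtain ⟨i, hi⟩ := exists_generator_pos
      (hS ▸ habove 0 (by lia) (F + 1) (by lia) (by lia)) F.succ_pos
    have hiT : g i ≤ T := by
      have : g i ≤ ∑ i, g i :=
        Finset.single_le_sum (fun _ _ => Nat.zero_le _) (Finset.mem_univ i)
      nlinarith
    have hgt (z : ℕ) (hz : F < z) : z ∈ S := by
      induction z using Nat.strong_induction_on with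
      | _ z ih =>
        by_cases hzB : z < B
        · exact habove (z - F - 1) (by lia) z hzB (by lia)
        · rw [show z = (z - g i) + g i by lia]
          exact add_mem (ih _ (by lia) (by lia))
            (hS ▸ AddSubmonoid.subset_closure (Set.mem_range_self i))
    have hgreatest : IsGreatest ((S : Set ℕ)ᶜ) F :=
      ⟨hFS, fun z hz => not_lt.1 fun h => hz (hgt z h)⟩
    refine ⟨(Set.finite_Iic F).subset hgreatest.2, ⟨F, hFS⟩, fun z hz => ?_⟩
    rw [hgreatest.csSup_eq]
    rcases lt_or_ge z 0 with hneg | hnonneg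
    · exact ⟨(F - z).toNat, hgt _ (by lia), by dsimp only; lia⟩
    · lift z to ℕ using hnonneg
      have hzS : z ∉ S := by simpa using hz
      have hzF : z ≤ F := hgreatest.2 hzS
      refine ⟨F - z, ?_, by dsimp only; lia⟩
      exact (hsymm z (by lia) (F - z) (by lia) (by lia)).resolve_left hzS

end Generators

theorem Polynomial.exists_eval_natCast_le_pow (p : ℤ[X]) :
    ∃ E N : ℕ, ∀ n : ℕ, N ≤ n → p.eval (n : ℤ) ≤ (n : ℤ) ^ E := by
  induction p using Polynomial.induction_on' with
  | add p q hp hq =>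
    obtain ⟨E, N, h⟩ := hp
    obtain ⟨E', N', h'⟩ := hq
    refine ⟨max E E' + 1, max 2 (max N N'), fun n hn => ?_⟩
    have hn1 : (1 : ℤ) ≤ n := by lia
    have hE : (n : ℤ) ^ E ≤ (n : ℤ) ^ max E E' := pow_le_pow_right₀ hn1 (le_max_left _ _)
    have hE' : (n : ℤ) ^ E' ≤ (n : ℤ) ^ max E E' := pow_le_pow_right₀ hn1 (le_max_right _ _)
    have hp := h n (by lia)
    have hq := h' n (by lia)
    have hn2 : (2 : ℤ) ≤ n := by lia
    rw [eval_add, pow_succ]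
    nlinarith [pow_nonneg (Int.natCast_nonneg n) (max E E')]
  | monomial d a =>
    refine ⟨d + 1, a.toNat, fun n hn => ?_⟩
    rw [eval_monomial, pow_succ, mul_comm]
    gcongr
    lia

/-! ### The main theorem -/

namespace DigitDefinable

variable {k : ℕ} {f : Fin k → ℕ → ℕ} {p : Fin k → ℤ[X]}

theorem mem_SG {D : ℕ} {ι : Type*} [Fintype ι] (hp : ∀ i (n : ℕ), (f i n : ℤ) = (p i).eval (n : ℤ))
    (i : ι) : DigitDefinable D fun n x => x i ∈ SG k f n := by
  classical
  refine (linear_eq_zero (ι := ι ⊕ Fin k) (Sum.elim (Pi.single i (-1)) p) 0).exists_lt.congr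
    fun n x hx => ?_
  rw [SG, mem_closure_range_iff_exists_lt (hx i)]
  refine exists_congr fun a => and_congr_right fun _ => ?_
  have hsingle : ∑ j, ((Pi.single i (-1) : ι → ℤ[X]) j).eval (n : ℤ) * (x j : ℤ) = -x i := by
    rw [Finset.sum_eq_single i] <;> simp +contextual
  have hsum : ∑ j, (p j).eval (n : ℤ) * (a j : ℤ) = ((∑ j, a j * f j n : ℕ) : ℤ) := by
    simp [← hp, mul_comm]
  simp only [Fintype.sum_sum_type, Sum.elim_inl, Sum.elim_inr, hsingle, hsum, eval_zero]
  lia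

theorem exists_symmetric (hp : ∀ i (n : ℕ), (f i n : ℤ) = (p i).eval (n : ℤ)) (E : ℕ) :
    DigitDefinable (E + 1) fun n (_ : Empty → ℕ) => ∃ F < n ^ (E + 1), F ∉ SG k f n ∧ F < n ^ E ∧
      (∀ w < n ^ (E + 1), ∀ z < n ^ (E + 1), F + w + 1 = z → z ∈ SG k f n) ∧
      ∀ w < n ^ (E + 1), ∀ z < n ^ (E + 1), w + z = F → w ∈ SG k f n ∨ z ∈ SG k f n := by
  have hbound : DigitDefinable (E + 1) fun n (x : Empty ⊕ Unit → ℕ) => x (.inr ()) < n ^ E := by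
    refine (linear_eq_zero (ι := (Empty ⊕ Unit) ⊕ Unit) 1 (1 - X ^ E)).exists_lt.congr
      fun n x hx => ?_
    have hlinear (u : Unit → ℕ) : (∑ i, ((1 : (Empty ⊕ Unit) ⊕ Unit → ℤ[X]) i).eval (n : ℤ) *
        ((Sum.elim x u i : ℕ) : ℤ) + (1 - X ^ E : ℤ[X]).eval (n : ℤ) = 0) ↔
          x (.inr ()) + u () + 1 = n ^ E := by
      simp
      zify
      constructor <;> intro h <;> linarith
    simp only [hlinear]
    refine ⟨fun ⟨u, _, hu⟩ => by lia, fun h => ?_⟩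
    have hn : 0 < n := by
      by_contra! h0
      simpa [Nat.le_zero.1 h0] using hx (.inr ())
    have hE : n ^ E ≤ n ^ (E + 1) := Nat.pow_le_pow_right hn E.le_succ
    exact ⟨fun _ => n ^ E - x (.inr ()) - 1, fun _ => by lia, by lia⟩
  have habove : DigitDefinable (E + 1) fun n (x : Empty ⊕ Unit → ℕ) =>
      ∀ y : Fin 2 → ℕ, (∀ i, y i < n ^ (E + 1)) →
        x (.inr ()) + y 0 + 1 = y 1 → y 1 ∈ SG k f n := by
    refine (imp (R := fun n (x : (Empty ⊕ Unit) ⊕ Fin 2 → ℕ) =>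
      x (.inl (.inr ())) + x (.inr 0) + 1 = x (.inr 1)) ?_ (mem_SG hp (.inr 1))).forall_lt
    refine (linear_eq_zero (Sum.elim 1 ![1, -1]) 1).congr fun n x _ => ?_
    simp
    lia
  have hsymm : DigitDefinable (E + 1) fun n (x : Empty ⊕ Unit → ℕ) =>
      ∀ y : Fin 2 → ℕ, (∀ i, y i < n ^ (E + 1)) →
        y 0 + y 1 = x (.inr ()) → y 0 ∈ SG k f n ∨ y 1 ∈ SG k f n := by
    refine (imp (R := fun n (x : (Empty ⊕ Unit) ⊕ Fin 2 → ℕ) =>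
      x (.inr 0) + x (.inr 1) = x (.inl (.inr ()))) ?_
      ((mem_SG hp (.inr 0)).or (mem_SG hp (.inr 1)))).forall_lt
    refine (linear_eq_zero (Sum.elim (-1) 1) 0).congr fun n x _ => ?_
    simp
    lia
  refine ((mem_SG hp (.inr ())).not.and (hbound.and (habove.and hsymm))).exists_lt.congr
    fun n x _ => ?_
  have hpair (P : ℕ → ℕ → Prop) :
      (∀ y : Fin 2 → ℕ, (∀ i, y i < n ^ (E + 1)) → P (y 0) (y 1)) ↔
        ∀ w < n ^ (E + 1), ∀ z < n ^ (E + 1), P w z :=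
    ⟨fun h w hw z hz => h ![w, z] (Fin.forall_fin_two.2 ⟨hw, hz⟩),
      fun h y hy => h _ (hy 0) _ (hy 1)⟩
  have hunit (P : ℕ → Prop) : (∃ y : Unit → ℕ, (∀ i, y i < n ^ (E + 1)) ∧ P (y ())) ↔
      ∃ F < n ^ (E + 1), P F :=
    ⟨fun ⟨y, hy, h⟩ => ⟨_, hy (), h⟩, fun ⟨F, hF, h⟩ => ⟨fun _ => F, fun _ => hF, h⟩⟩
  rw [← hunit]
  refine exists_congr fun y => and_congr_right fun _ => and_congr_right fun _ =>
    and_congr_right fun _ => and_congr ?_ ?_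
  · exact hpair fun w z => y () + w + 1 = z → z ∈ SG k f n
  · exact hpair fun w z => w + z = y () → w ∈ SG k f n ∨ z ∈ SG k f n

end DigitDefinable

theorem stmt5 (k : ℕ) (hk : 1 ≤ k) (f : Fin k → ℕ → ℕ)
    (hf : ∀ i, ∃ p : Polynomial ℤ, ∀ n : ℕ, (f i n : ℤ) = p.eval (n : ℤ)) :
    EvPeriodicSet {n : ℕ |
      ((SG k f n : Set ℕ)ᶜ).Finite ∧ ((SG k f n : Set ℕ)ᶜ).Nonempty ∧
      ∀ z : ℤ, z ∉ SGZ k f n →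
        ((sSup ((SG k f n : Set ℕ)ᶜ) : ℕ) : ℤ) - z ∈ SGZ k f n} := by
  choose p hp using hf
  obtain ⟨E, N, hEN⟩ := ((∑ i, p i) ^ 2).exists_eval_natCast_le_pow
  obtain ⟨N', q, hq, hper⟩ := (DigitDefinable.exists_symmetric hp E).evPeriodicSet
  have hchar (m : ℕ) (hm : max 3 N ≤ m) := by
    refine symmetric_iff_exists_lt (g := fun i => f i m) (T := m ^ E) (B := m ^ (E + 1))
      ?_ ?_ (S := SG k f m) rfl
    · have := hEN m (by lia)
      rw [eval_pow, eval_finsetSum] at this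
      simp_rw [← hp] at this
      exact_mod_cast this
    · have hpos : 0 < m ^ E := by apply pow_pos; lia
      rw [pow_succ]
      nlinarith [le_of_max_le_left hm]
  refine ⟨max (max 3 N) N', q, hq, fun n hn => ?_⟩
  have hper' := hper n (by lia)
  simp only [Set.mem_ofPred_eq, show 0 < n by lia, show 0 < n + q by lia, true_and] at hper'
  exact (hchar n (by lia)).trans (hper'.trans (hchar (n + q) (by lia)).symm)
end
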